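/- arXiv:2006.14455 — 3 statements merged into one kernel-verified Lean document; each statement's English description precedes it below -/
import Mathlib

section
/- Let b : (0,∞) → (0,∞) be slowly varying and define, for t ∈ (0,∞), b̃(t) = ∫₀ᵗ s^{−1} b(s) ds, b̃_∞(t) = esssup_{s∈(0,t)} b(s), b̂(t) = ∫_t^∞ s^{−1} b(s) ds, and b̂_∞(t) = esssup_{s∈(t,∞)} b(s). Then b ≲ b̃, b ≲ b̃_∞, b ≲ b̂, and b ≲ b̂_∞ on (0,∞); each of the four functions b̃, b̃_∞, b̂, b̂_∞ is slowly varying if and only if it is finite almost everywhere on (0,∞); and moreover limsup_{t→0⁺} b̃(t)/b(t) = limsup_{t→∞} b̃(t)/b(t) = ∞ and limsup_{t→0⁺} b̂(t)/b(t) = limsup_{t→∞} b̂(t)/b(t) = ∞. -/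
open MeasureTheory Set Filter ENNReal Topology

noncomputable section

/-- `f ≈ g` on `S`: two-sided equivalence with positive constants. -/
def EquivOn (f g : ℝ → ℝ) (S : Set ℝ) : Prop :=
  ∃ c C : ℝ, 0 < c ∧ 0 < C ∧ ∀ t ∈ S, c * g t ≤ f t ∧ f t ≤ C * g t

/-- A measurable positive function on `(0,∞)` is slowly varying if for every `ε > 0`,
`t ^ ε * b t` is equivalent to a non-decreasing function and `t ^ (-ε) * b t` is
equivalent to a non-increasing function on `(0,∞)`. -/
def IsSlowlyVarying (b : ℝ → ℝ) : Prop :=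
  Measurable b ∧ (∀ t ∈ Set.Ioi (0:ℝ), 0 < b t) ∧
    ∀ ε : ℝ, 0 < ε →
      (∃ bp : ℝ → ℝ, MonotoneOn bp (Set.Ioi 0) ∧
        EquivOn (fun t => t ^ ε * b t) bp (Set.Ioi 0)) ∧
      (∃ bm : ℝ → ℝ, AntitoneOn bm (Set.Ioi 0) ∧
        EquivOn (fun t => t ^ (-ε) * b t) bm (Set.Ioi 0))

/-- The non-increasing rearrangement `f*` (with values in `ℝ≥0∞`). -/
def rearr {X : Type*} [MeasurableSpace X] (μ : Measure X) (f : X → ℝ) (t : ℝ) : ℝ≥0∞ :=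
  sInf {s : ℝ≥0∞ | μ {x | s < ENNReal.ofReal |f x|} ≤ ENNReal.ofReal t}

/-- The maximal function `f**(t) = (1/t) ∫₀ᵗ f*`. -/
def maxf {X : Type*} [MeasurableSpace X] (μ : Measure X) (f : X → ℝ) (t : ℝ) : ℝ≥0∞ :=
  (ENNReal.ofReal t)⁻¹ * ∫⁻ s in Set.Ioo (0:ℝ) t, rearr μ f s

/-- The `L^q` "norm" over a subset `S ⊆ ℝ` of an `ℝ≥0∞`-valued function. -/
def lqNorm (q : ℝ≥0∞) (S : Set ℝ) (g : ℝ → ℝ≥0∞) : ℝ≥0∞ :=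
  if q = ∞ then essSup g (volume.restrict S)
  else (∫⁻ t in S, g t ^ q.toReal) ^ (1 / q.toReal)

/-- The Lorentz–Karamata functional `‖f‖_{p,q,b}`. -/
def lkNorm {X : Type*} [MeasurableSpace X] (μ : Measure X) (p q : ℝ≥0∞) (b : ℝ → ℝ)
    (f : X → ℝ) : ℝ≥0∞ :=
  lqNorm q (Set.Ioi 0)
    (fun t => ENNReal.ofReal (t ^ (p⁻¹.toReal - q⁻¹.toReal) * b t) * rearr μ f t)

/-- The Lorentz–Karamata functional `‖f‖_{(p,q,b)}` defined via the maximal function. -/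
def lkMaxNorm {X : Type*} [MeasurableSpace X] (μ : Measure X) (p q : ℝ≥0∞) (b : ℝ → ℝ)
    (f : X → ℝ) : ℝ≥0∞ :=
  lqNorm q (Set.Ioi 0)
    (fun t => ENNReal.ofReal (t ^ (p⁻¹.toReal - q⁻¹.toReal) * b t) * maxf μ f t)

/-- The `L^q(0,∞)` norm of `t ^ (1/p - 1/q) * b t` restricted to `S`. -/
def weightNorm (p q : ℝ≥0∞) (b : ℝ → ℝ) (S : Set ℝ) : ℝ≥0∞ :=
  lqNorm q S (fun t => ENNReal.ofReal (t ^ (p⁻¹.toReal - q⁻¹.toReal) * b t))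

/-- A measure is non-atomic. -/
def IsNonatomic {X : Type*} [MeasurableSpace X] (μ : Measure X) : Prop :=
  ∀ s : Set X, MeasurableSet s → 0 < μ s →
    ∃ t, t ⊆ s ∧ MeasurableSet t ∧ 0 < μ t ∧ μ t < μ s

/-- `b̃(t) = ∫₀ᵗ s⁻¹ b(s) ds`. -/
def svTilde (b : ℝ → ℝ) (t : ℝ) : ℝ≥0∞ :=
  ∫⁻ s in Set.Ioo (0:ℝ) t, ENNReal.ofReal (s⁻¹ * b s)

/-- `b̃_∞(t) = esssup_{s ∈ (0,t)} b(s)`. -/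
def svTildeSup (b : ℝ → ℝ) (t : ℝ) : ℝ≥0∞ :=
  essSup (fun s => ENNReal.ofReal (b s)) (volume.restrict (Set.Ioo (0:ℝ) t))

/-- `b̂(t) = ∫_t^∞ s⁻¹ b(s) ds`. -/
def svHat (b : ℝ → ℝ) (t : ℝ) : ℝ≥0∞ :=
  ∫⁻ s in Set.Ioi t, ENNReal.ofReal (s⁻¹ * b s)

/-- `b̂_∞(t) = esssup_{s ∈ (t,∞)} b(s)`. -/
def svHatSup (b : ℝ → ℝ) (t : ℝ) : ℝ≥0∞ :=
  essSup (fun s => ENNReal.ofReal (b s)) (volume.restrict (Set.Ioi t))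

/-- The associate functional of a functional `N`. -/
def assocNorm {X : Type*} [MeasurableSpace X] (μ : Measure X) (N : (X → ℝ) → ℝ≥0∞)
    (f : X → ℝ) : ℝ≥0∞ :=
  ⨆ (g : X → ℝ) (_ : Measurable g) (_ : N g ≤ 1), ∫⁻ x, ENNReal.ofReal |f x * g x| ∂μ

/-- The conjugate exponent: `q' = q/(q-1)` for `q ∈ (1,∞)`, `1' = ∞`, `∞' = 1`. -/
def conjE (q : ℝ≥0∞) : ℝ≥0∞ := (1 - q⁻¹)⁻¹

/-- The interval `(0, μ(R))` inside `ℝ`, where `μ(R)` may be infinite. -/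
def IooMu {X : Type*} [MeasurableSpace X] (μ : Measure X) : Set ℝ :=
  {t : ℝ | 0 < t ∧ ENNReal.ofReal t < μ Set.univ}

/-- The embedding `L^{p₁,q₁,b₁} ↪ L^{p₂,q₂,b₂}`. -/
def lkEmbed {X : Type*} [MeasurableSpace X] (μ : Measure X) (p1 q1 : ℝ≥0∞) (b1 : ℝ → ℝ)
    (p2 q2 : ℝ≥0∞) (b2 : ℝ → ℝ) : Prop :=
  ∃ C : ℝ≥0∞, C < ∞ ∧ ∀ f : X → ℝ, Measurable f →
    lkNorm μ p2 q2 b2 f ≤ C * lkNorm μ p1 q1 b1 f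

/-- A rearrangement-invariant quasi-Banach function norm. -/
structure IsRIQuasiBFN {X : Type*} [MeasurableSpace X] (μ : Measure X)
    (N : (X → ℝ) → ℝ≥0∞) : Prop where
  abs_eq : ∀ f : X → ℝ, Measurable f → N (fun x => |f x|) = N f
  smul : ∀ (a : ℝ) (f : X → ℝ), Measurable f →
    N (fun x => a * f x) = ENNReal.ofReal |a| * N f
  eq_zero_iff : ∀ f : X → ℝ, Measurable f → (N f = 0 ↔ f =ᵐ[μ] 0)
  quasi_add : ∃ C : ℝ≥0∞, C < ∞ ∧ ∀ f g : X → ℝ, Measurable f → Measurable g →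
    N (fun x => f x + g x) ≤ C * (N f + N g)
  mono : ∀ f g : X → ℝ, Measurable f → Measurable g →
    (∀ᵐ x ∂μ, |f x| ≤ |g x|) → N f ≤ N g
  fatou : ∀ (f : ℕ → X → ℝ) (g : X → ℝ), (∀ n, Measurable (f n)) → Measurable g →
    (∀ᵐ x ∂μ, ∀ n, 0 ≤ f n x) → (∀ᵐ x ∂μ, Monotone fun n => f n x) →
    (∀ᵐ x ∂μ, Filter.Tendsto (fun n => f n x) Filter.atTop (nhds (g x))) →
    N g = ⨆ n, N (f n)
  ind_lt_top : ∀ E : Set X, MeasurableSet E → μ E < ∞ →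
    N (Set.indicator E fun _ => (1:ℝ)) < ∞
  rearr_inv : ∀ f g : X → ℝ, Measurable f → Measurable g →
    rearr μ f = rearr μ g → N f = N g

/-- A rearrangement-invariant Banach function norm. -/
structure IsRIBFN {X : Type*} [MeasurableSpace X] (μ : Measure X)
    (N : (X → ℝ) → ℝ≥0∞) : Prop where
  abs_eq : ∀ f : X → ℝ, Measurable f → N (fun x => |f x|) = N f
  smul : ∀ (a : ℝ) (f : X → ℝ), Measurable f →
    N (fun x => a * f x) = ENNReal.ofReal |a| * N f
  eq_zero_iff : ∀ f : X → ℝ, Measurable f → (N f = 0 ↔ f =ᵐ[μ] 0)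
  add_le : ∀ f g : X → ℝ, Measurable f → Measurable g →
    N (fun x => f x + g x) ≤ N f + N g
  mono : ∀ f g : X → ℝ, Measurable f → Measurable g →
    (∀ᵐ x ∂μ, |f x| ≤ |g x|) → N f ≤ N g
  fatou : ∀ (f : ℕ → X → ℝ) (g : X → ℝ), (∀ n, Measurable (f n)) → Measurable g →
    (∀ᵐ x ∂μ, ∀ n, 0 ≤ f n x) → (∀ᵐ x ∂μ, Monotone fun n => f n x) →
    (∀ᵐ x ∂μ, Filter.Tendsto (fun n => f n x) Filter.atTop (nhds (g x))) →
    N g = ⨆ n, N (f n)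
  ind_lt_top : ∀ E : Set X, MeasurableSet E → μ E < ∞ →
    N (Set.indicator E fun _ => (1:ℝ)) < ∞
  integral_le : ∀ E : Set X, MeasurableSet E → μ E < ∞ →
    ∃ C : ℝ≥0∞, C < ∞ ∧ ∀ f : X → ℝ, Measurable f →
      ∫⁻ x in E, ENNReal.ofReal |f x| ∂μ ≤ C * N f
  rearr_inv : ∀ f g : X → ℝ, Measurable f → Measurable g →
    rearr μ f = rearr μ g → N f = N g

end

namespace IsSlowlyVarying

variable {b : ℝ → ℝ}

/-- A Potter-type bound: up to a constant, `b` varies by at most `(t / s) ^ ε` between `s ≤ t`. -/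
lemma potter (hb : IsSlowlyVarying b) {ε : ℝ} (hε : 0 < ε) :
    ∃ C : ℝ, 0 < C ∧ ∀ s t, 0 < s → s ≤ t →
      b s ≤ C * (t / s) ^ ε * b t ∧ b t ≤ C * (t / s) ^ ε * b s := by
  obtain ⟨-, hpos, h⟩ := hb
  obtain ⟨⟨p, hp, c, C, hc, hC, h1⟩, ⟨m, hm, d, D, hd, hD, h2⟩⟩ := h ε hε
  refine ⟨C / c + D / d, by positivity, fun s t hs hst => ?_⟩
  have ht : 0 < t := hs.trans_le hst
  have hs' : 0 < s ^ ε := Real.rpow_pos_of_pos hs ε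
  have ht' : 0 < t ^ ε := Real.rpow_pos_of_pos ht ε
  have hbs : 0 < b s := hpos s hs
  have hbt : 0 < b t := hpos t ht
  have e1 : s ^ ε * b s ≤ C / c * (t ^ ε * b t) := by
    calc s ^ ε * b s ≤ C * p s := (h1 s hs).2
      _ ≤ C * p t := by gcongr; exact hp hs ht hst
      _ = C / c * (c * p t) := by field_simp
      _ ≤ _ := mul_le_mul_of_nonneg_left (h1 t ht).1 (by positivity)
  have e2 : t ^ (-ε) * b t ≤ D / d * (s ^ (-ε) * b s) := by
    calc t ^ (-ε) * b t ≤ D * m t := (h2 t ht).2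
      _ ≤ D * m s := by gcongr; exact hm hs ht hst
      _ = D / d * (d * m s) := by field_simp
      _ ≤ _ := mul_le_mul_of_nonneg_left (h2 s hs).1 (by positivity)
  rw [Real.rpow_neg ht.le, Real.rpow_neg hs.le] at e2
  rw [Real.div_rpow ht.le hs.le]
  constructor
  · calc b s = (s ^ ε)⁻¹ * (s ^ ε * b s) := by field_simp
      _ ≤ (s ^ ε)⁻¹ * (C / c * (t ^ ε * b t)) := by gcongr
      _ = C / c * (t ^ ε / s ^ ε) * b t := by ring
      _ ≤ _ := by gcongr; exact le_add_of_nonneg_right (by positivity)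
  · calc b t = t ^ ε * ((t ^ ε)⁻¹ * b t) := by field_simp
      _ ≤ t ^ ε * (D / d * ((s ^ ε)⁻¹ * b s)) := by gcongr
      _ = D / d * (t ^ ε / s ^ ε) * b s := by ring
      _ ≤ _ := by gcongr; exact le_add_of_nonneg_left (by positivity)

lemma exists_doubling (hb : IsSlowlyVarying b) :
    ∃ D : ℝ, 0 < D ∧ ∀ s t, 0 < s → s ≤ t → t ≤ 2 * s → b s ≤ D * b t ∧ b t ≤ D * b s := by
  obtain ⟨C, hC, h⟩ := hb.potter one_pos
  refine ⟨C * 2, by positivity, fun s t hs hst hts => ?_⟩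
  have hq : t / s ≤ 2 := by rwa [div_le_iff₀ hs]
  have hbs := hb.2.1 s hs
  have hbt := hb.2.1 t (hs.trans_le hst)
  obtain ⟨h1, h2⟩ := h s t hs hst
  rw [Real.rpow_one] at h1 h2
  exact ⟨h1.trans (by gcongr), h2.trans (by gcongr)⟩

lemma exists_geometric (hb : IsSlowlyVarying b) {r : ℝ} (hr : 1 < r) :
    ∃ C : ℝ, 0 < C ∧ ∀ (n : ℕ) (t : ℝ), 0 < t →
      b t ≤ C * r ^ n * b (t * 2 ^ n) ∧ b (t * 2 ^ n) ≤ C * r ^ n * b t := by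
  obtain ⟨C, hC, h⟩ := hb.potter (Real.logb_pos one_lt_two hr)
  refine ⟨C, hC, fun n t ht => ?_⟩
  have key : (t * 2 ^ n / t) ^ Real.logb 2 r = r ^ n := by
    rw [mul_div_cancel_left₀ _ ht.ne', ← Real.rpow_natCast, ← Real.rpow_mul two_pos.le, mul_comm,
      Real.rpow_mul two_pos.le, Real.rpow_logb two_pos (by norm_num) (by linarith),
      Real.rpow_natCast]
  have := h t (t * 2 ^ n) ht (le_mul_of_one_le_right ht.le (one_le_pow₀ one_le_two))
  rwa [key] at this

end IsSlowlyVarying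

section Construction

variable {f : ℝ → ℝ} {C : ℝ}

lemma exists_monotoneOn_equivOn (hC : 0 < C) (h : ∀ s t, 0 < s → s ≤ t → f s ≤ C * f t) :
    ∃ g : ℝ → ℝ, MonotoneOn g (Ioi 0) ∧ EquivOn f g (Ioi 0) := by
  have bdd : ∀ t, C * f t ∈ upperBounds (f '' Ioc 0 t) := by
    rintro t _ ⟨s, hs, rfl⟩
    exact h s t hs.1 hs.2
  have ne : ∀ t ∈ Ioi (0 : ℝ), (f '' Ioc 0 t).Nonempty := fun t ht => ⟨f t, t, ⟨ht, le_rfl⟩, rfl⟩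
  refine ⟨fun t => sSup (f '' Ioc 0 t), fun s hs t _ hst => ?_, C⁻¹, 1, by positivity, one_pos,
    fun t ht => ⟨?_, ?_⟩⟩
  · exact csSup_le_csSup ⟨_, bdd t⟩ (ne s hs) (image_mono (Ioc_subset_Ioc_right hst))
  · rw [inv_mul_le_iff₀ hC]
    exact csSup_le (ne t ht) (bdd t)
  · rw [one_mul]
    exact le_csSup ⟨_, bdd t⟩ ⟨t, ⟨ht, le_rfl⟩, rfl⟩

lemma exists_antitoneOn_equivOn (hC : 0 < C) (h : ∀ s t, 0 < s → s ≤ t → f t ≤ C * f s) :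
    ∃ g : ℝ → ℝ, AntitoneOn g (Ioi 0) ∧ EquivOn f g (Ioi 0) := by
  have bdd : ∀ t ∈ Ioi (0 : ℝ), C * f t ∈ upperBounds (f '' Ici t) := by
    rintro t ht _ ⟨s, hs, rfl⟩
    exact h t s ht hs
  have ne : ∀ t, (f '' Ici t).Nonempty := fun t => ⟨f t, t, self_mem_Ici, rfl⟩
  refine ⟨fun t => sSup (f '' Ici t), fun s hs t ht hst => ?_, C⁻¹, 1, by positivity, one_pos,
    fun t ht => ⟨?_, ?_⟩⟩
  · exact csSup_le_csSup ⟨_, bdd s hs⟩ (ne t) (image_mono (Ici_subset_Ici.2 hst))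
  · rw [inv_mul_le_iff₀ hC]
    exact csSup_le (ne t) (bdd t ht)
  · rw [one_mul]
    exact le_csSup ⟨_, bdd t ht⟩ ⟨t, self_mem_Ici, rfl⟩

lemma isSlowlyVarying_toReal {F : ℝ → ℝ≥0∞} (hm : Measurable F) (h0 : ∀ t, 0 < t → F t ≠ 0)
    (hfin : ∀ t, 0 < t → F t ≠ ∞)
    (h : ∀ ε : ℝ, 0 < ε → ∃ C : ℝ, 0 < C ∧ ∀ s t, 0 < s → s ≤ t →
      F s ≤ ENNReal.ofReal (C * (t / s) ^ ε) * F t ∧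
      F t ≤ ENNReal.ofReal (C * (t / s) ^ ε) * F s) :
    IsSlowlyVarying (fun t => (F t).toReal) := by
  refine ⟨hm.ennreal_toReal, fun t ht => ENNReal.toReal_pos (h0 t ht) (hfin t ht),
    fun ε hε => ?_⟩
  obtain ⟨C, hC, hF⟩ := h ε hε
  have hR : ∀ s t, 0 < s → s ≤ t →
      (F s).toReal ≤ C * (t ^ ε / s ^ ε) * (F t).toReal ∧
      (F t).toReal ≤ C * (t ^ ε / s ^ ε) * (F s).toReal := fun s t hs hst => by
    have ht := hs.trans_le hst
    rw [← Real.div_rpow ht.le hs.le]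
    have hc : 0 ≤ C * (t / s) ^ ε := by positivity
    obtain ⟨h1, h2⟩ := hF s t hs hst
    constructor
    · simpa [ENNReal.toReal_ofReal hc] using
        ENNReal.toReal_mono (ENNReal.mul_ne_top ENNReal.ofReal_ne_top (hfin t ht)) h1
    · simpa [ENNReal.toReal_ofReal hc] using
        ENNReal.toReal_mono (ENNReal.mul_ne_top ENNReal.ofReal_ne_top (hfin s hs)) h2
  constructor
  · refine exists_monotoneOn_equivOn hC fun s t hs hst => ?_
    have hs' : 0 < s ^ ε := Real.rpow_pos_of_pos hs ε
    calc s ^ ε * (F s).toReal ≤ s ^ ε * (C * (t ^ ε / s ^ ε) * (F t).toReal) := by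
          gcongr; exact (hR s t hs hst).1
      _ = C * (t ^ ε * (F t).toReal) := by field_simp
  · refine exists_antitoneOn_equivOn hC fun s t hs hst => ?_
    have ht := hs.trans_le hst
    have hs' : 0 < s ^ ε := Real.rpow_pos_of_pos hs ε
    have ht' : 0 < t ^ ε := Real.rpow_pos_of_pos ht ε
    rw [Real.rpow_neg ht.le, Real.rpow_neg hs.le]
    calc (t ^ ε)⁻¹ * (F t).toReal ≤ (t ^ ε)⁻¹ * (C * (t ^ ε / s ^ ε) * (F s).toReal) := by
          gcongr; exact (hR s t hs hst).2
      _ = C * ((s ^ ε)⁻¹ * (F s).toReal) := by field_simp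

end Construction

section Basic

variable (b : ℝ → ℝ)

lemma svTilde_mono : Monotone (svTilde b) := fun _ _ h =>
  lintegral_mono_set (Ioo_subset_Ioo_right h)

lemma svHat_anti : Antitone (svHat b) := fun _ _ h =>
  lintegral_mono_set (Ioi_subset_Ioi h)

lemma svTildeSup_mono : Monotone (svTildeSup b) := fun _ _ h =>
  essSup_mono_measure' (Measure.restrict_mono (Ioo_subset_Ioo_right h) le_rfl)

lemma svHatSup_anti : Antitone (svHatSup b) := fun _ _ h =>
  essSup_mono_measure' (Measure.restrict_mono (Ioi_subset_Ioi h) le_rfl)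

variable {b}

lemma le_mul_setLIntegral_Ioo {A : ℝ≥0∞} {M t : ℝ} (ht : 0 < t) (hM : 0 < M)
    (hb : Measurable b) (h : ∀ s ∈ Ioo t (2 * t), A ≤ ENNReal.ofReal M * ENNReal.ofReal (b s)) :
    A ≤ ENNReal.ofReal (2 * M) * ∫⁻ s in Ioo t (2 * t), ENNReal.ofReal (s⁻¹ * b s) := by
  have hI : ∫⁻ _ in Ioo t (2 * t), ENNReal.ofReal t⁻¹ * A = A := by
    rw [setLIntegral_const, Real.volume_Ioo, mul_right_comm, ← ENNReal.ofReal_mul (by positivity),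
      two_mul, add_sub_cancel_right, inv_mul_cancel₀ ht.ne', ENNReal.ofReal_one, one_mul]
  rw [← lintegral_const_mul _ (by fun_prop)]
  conv_lhs => rw [← hI]
  refine setLIntegral_mono' measurableSet_Ioo fun s hs => ?_
  have hs0 : 0 < s := ht.trans hs.1
  have : t⁻¹ ≤ 2 * s⁻¹ := by
    rw [← div_eq_mul_inv, le_div_iff₀ hs0, inv_mul_le_iff₀ ht]
    linarith [hs.2]
  calc ENNReal.ofReal t⁻¹ * A
      ≤ ENNReal.ofReal (2 * s⁻¹) * (ENNReal.ofReal M * ENNReal.ofReal (b s)) := by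
        gcongr; exact h s hs
    _ = _ := by
        rw [← ENNReal.ofReal_mul hM.le, ← ENNReal.ofReal_mul (by positivity),
          ← ENNReal.ofReal_mul (by positivity)]
        congr 1; ring

lemma le_mul_essSup_restrict {f : ℝ → ℝ≥0∞} {A K : ℝ≥0∞} {S : Set ℝ} {u v : ℝ} (huv : u < v)
    (hS : Ioo u v ⊆ S) (h : ∀ s ∈ Ioo u v, A ≤ K * f s) :
    A ≤ K * essSup f (volume.restrict S) := by
  have hne : volume.restrict (Ioo u v) ≠ 0 := by
    simp [Measure.restrict_eq_zero, huv]
  have : NeBot (ae (volume.restrict (Ioo u v))) := ae_neBot.2 hne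
  have h1 : ∀ᵐ s ∂(volume.restrict (Ioo u v)), f s ≤ essSup f (volume.restrict S) :=
    ae_restrict_of_ae_restrict_of_subset hS (ENNReal.ae_le_essSup f)
  obtain ⟨s, hs, hs'⟩ := (h1.and (ae_restrict_mem measurableSet_Ioo)).exists
  exact (h s hs').trans (by gcongr)

lemma ofReal_le_ofReal_mul {x y D : ℝ} (hD : 0 < D) (h : x ≤ D * y) :
    ENNReal.ofReal x ≤ ENNReal.ofReal D * ENNReal.ofReal y := by
  rw [← ENNReal.ofReal_mul hD.le]
  exact ENNReal.ofReal_le_ofReal h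

end Basic

namespace IsSlowlyVarying

variable {b : ℝ → ℝ}

lemma exists_le_svTilde (hb : IsSlowlyVarying b) :
    ∃ C : ℝ, 0 < C ∧ ∀ t, 0 < t → ENNReal.ofReal (b t) ≤ ENNReal.ofReal C * svTilde b t := by
  obtain ⟨D, hD, h⟩ := hb.exists_doubling
  refine ⟨2 * D, by positivity, fun t ht => ?_⟩
  refine (le_mul_setLIntegral_Ioo (half_pos ht) hD hb.1 fun s hs => ?_).trans ?_
  · exact ofReal_le_ofReal_mul hD
      (h s t ((half_pos ht).trans hs.1) (by linarith [hs.2]) (by linarith [hs.1])).2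
  · gcongr
    exact lintegral_mono_set (Ioo_subset_Ioo (half_pos ht).le (by linarith))

lemma exists_le_svHat (hb : IsSlowlyVarying b) :
    ∃ C : ℝ, 0 < C ∧ ∀ t, 0 < t → ENNReal.ofReal (b t) ≤ ENNReal.ofReal C * svHat b t := by
  obtain ⟨D, hD, h⟩ := hb.exists_doubling
  refine ⟨2 * D, by positivity, fun t ht => ?_⟩
  refine (le_mul_setLIntegral_Ioo ht hD hb.1 fun s hs => ?_).trans ?_
  · exact ofReal_le_ofReal_mul hD (h t s ht hs.1.le hs.2.le).1
  · gcongr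
    exact lintegral_mono_set Ioo_subset_Ioi_self

lemma exists_le_svTildeSup (hb : IsSlowlyVarying b) :
    ∃ C : ℝ, 0 < C ∧ ∀ t, 0 < t → ENNReal.ofReal (b t) ≤ ENNReal.ofReal C * svTildeSup b t := by
  obtain ⟨D, hD, h⟩ := hb.exists_doubling
  refine ⟨D, hD, fun t ht => ?_⟩
  refine le_mul_essSup_restrict (half_lt_self ht) (Ioo_subset_Ioo_left (half_pos ht).le)
    fun s hs => ?_
  exact ofReal_le_ofReal_mul hD
    (h s t ((half_pos ht).trans hs.1) hs.2.le (by linarith [hs.1])).2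

lemma exists_le_svHatSup (hb : IsSlowlyVarying b) :
    ∃ C : ℝ, 0 < C ∧ ∀ t, 0 < t → ENNReal.ofReal (b t) ≤ ENNReal.ofReal C * svHatSup b t := by
  obtain ⟨D, hD, h⟩ := hb.exists_doubling
  refine ⟨D, hD, fun t ht => ?_⟩
  refine le_mul_essSup_restrict (by linarith : t < 2 * t) Ioo_subset_Ioi_self fun s hs => ?_
  exact ofReal_le_ofReal_mul hD (h t s ht hs.1.le hs.2.le).1

end IsSlowlyVarying

lemma ne_zero_of_ofReal_le_mul {F : ℝ → ℝ≥0∞} {b : ℝ → ℝ} {C : ℝ} (hb : IsSlowlyVarying b)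
    (h : ∀ t, 0 < t → ENNReal.ofReal (b t) ≤ ENNReal.ofReal C * F t) (t : ℝ) (ht : 0 < t) :
    F t ≠ 0 := fun h0 => by
  have h1 := h t ht
  rw [h0, mul_zero, nonpos_iff_eq_zero, ENNReal.ofReal_eq_zero] at h1
  exact (hb.2.1 t ht).not_ge h1

lemma IsSlowlyVarying.lt_top {F : ℝ → ℝ≥0∞} (h : IsSlowlyVarying (fun t => (F t).toReal)) :
    ∀ᵐ t ∂(volume.restrict (Ioi (0 : ℝ))), F t < ∞ := by
  filter_upwards [ae_restrict_mem measurableSet_Ioi] with t ht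
  exact (ENNReal.toReal_pos_iff.1 (h.2.1 t ht)).2

lemma exists_mem_Ioo_of_ae {p : ℝ → Prop} (h : ∀ᵐ t ∂(volume.restrict (Ioi (0 : ℝ))), p t)
    {u v : ℝ} (hu : 0 ≤ u) (huv : u < v) : ∃ s ∈ Ioo u v, p s := by
  have hne : volume.restrict (Ioo u v) ≠ 0 := by
    simp [Measure.restrict_eq_zero, huv]
  have : NeBot (ae (volume.restrict (Ioo u v))) := ae_neBot.2 hne
  have h1 : ∀ᵐ s ∂(volume.restrict (Ioo u v)), p s :=
    ae_restrict_of_ae_restrict_of_subset (fun x hx => hu.trans_lt hx.1) h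
  obtain ⟨s, hs, hs'⟩ := (h1.and (ae_restrict_mem measurableSet_Ioo)).exists
  exact ⟨s, hs', hs⟩

lemma Monotone.ne_top_of_ae {F : ℝ → ℝ≥0∞} (hF : Monotone F)
    (h : ∀ᵐ t ∂(volume.restrict (Ioi (0 : ℝ))), F t < ∞) (t : ℝ) (ht : 0 < t) : F t ≠ ∞ := by
  obtain ⟨s, hs, hs'⟩ := exists_mem_Ioo_of_ae h ht.le (lt_add_one t)
  exact ((hF hs.1.le).trans_lt hs').ne

lemma Antitone.ne_top_of_ae {F : ℝ → ℝ≥0∞} (hF : Antitone F)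
    (h : ∀ᵐ t ∂(volume.restrict (Ioi (0 : ℝ))), F t < ∞) (t : ℝ) (ht : 0 < t) : F t ≠ ∞ := by
  obtain ⟨s, hs, hs'⟩ := exists_mem_Ioo_of_ae h le_rfl ht
  exact ((hF hs.2.le).trans_lt hs').ne

lemma setLIntegral_comp_mul_left {h : ℝ → ℝ≥0∞} (hh : Measurable h) {S : Set ℝ}
    (hS : MeasurableSet S) {a : ℝ} (ha : 0 < a) :
    ∫⁻ s in S, h s = ENNReal.ofReal a * ∫⁻ u in (a * ·) ⁻¹' S, h (a * u) := by
  conv_lhs => rw [← Real.smul_map_volume_mul_left ha.ne', Measure.restrict_smul,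
    lintegral_smul_measure, setLIntegral_map hS hh (measurable_const_mul a), abs_of_pos ha,
    smul_eq_mul]

lemma setLIntegral_inv_mul_comp_mul_left {b : ℝ → ℝ} (hb : Measurable b) {S : Set ℝ}
    (hS : MeasurableSet S) {a : ℝ} (ha : 0 < a) :
    ∫⁻ s in S, ENNReal.ofReal (s⁻¹ * b s) =
      ∫⁻ u in (a * ·) ⁻¹' S, ENNReal.ofReal (u⁻¹ * b (a * u)) := by
  rw [setLIntegral_comp_mul_left (by fun_prop) hS ha, ← lintegral_const_mul _ (by fun_prop)]
  refine lintegral_congr fun u => ?_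
  rw [← ENNReal.ofReal_mul ha.le, mul_inv]
  congr 1
  field_simp

lemma setLIntegral_le_of_le {c d : ℝ → ℝ} {K : ℝ} (hK : 0 < K) (hd : Measurable d)
    {S : Set ℝ} (hS : MeasurableSet S) (h : ∀ s ∈ S, 0 < s ∧ c s ≤ K * d s) :
    ∫⁻ s in S, ENNReal.ofReal (s⁻¹ * c s) ≤
      ENNReal.ofReal K * ∫⁻ s in S, ENNReal.ofReal (s⁻¹ * d s) := by
  rw [← lintegral_const_mul _ (by fun_prop)]
  refine setLIntegral_mono' hS fun s hs => ofReal_le_ofReal_mul hK ?_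
  have := (h s hs).1
  calc s⁻¹ * c s ≤ s⁻¹ * (K * d s) := by gcongr; exact (h s hs).2
    _ = _ := by ring

namespace IsSlowlyVarying

variable {b : ℝ → ℝ}

lemma comp_mul_bounds {C ε : ℝ} (h : ∀ s t, 0 < s → s ≤ t →
      b s ≤ C * (t / s) ^ ε * b t ∧ b t ≤ C * (t / s) ^ ε * b s) {s t u : ℝ}
    (hs : 0 < s) (hst : s ≤ t) (hu : 0 < u) :
    b u ≤ C * (t / s) ^ ε * b (t / s * u) ∧ b (t / s * u) ≤ C * (t / s) ^ ε * b u := by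
  have := h u (t / s * u) hu (le_mul_of_one_le_left hu.le ((one_le_div hs).2 hst))
  rwa [mul_div_cancel_right₀ _ hu.ne'] at this

lemma svTilde_toReal (hb : IsSlowlyVarying b)
    (hfin : ∀ᵐ t ∂(volume.restrict (Ioi (0 : ℝ))), svTilde b t < ∞) :
    IsSlowlyVarying (fun t => (svTilde b t).toReal) := by
  obtain ⟨K, hK, hle⟩ := hb.exists_le_svTilde
  refine isSlowlyVarying_toReal (svTilde_mono b).measurable (ne_zero_of_ofReal_le_mul hb hle)
    ((svTilde_mono b).ne_top_of_ae hfin) fun ε hε => ?_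
  obtain ⟨C, hC, h⟩ := hb.potter hε
  refine ⟨C, hC, fun s t hs hst => ?_⟩
  have ht := hs.trans_le hst
  have hm := hb.1
  have ha : 0 < t / s := by positivity
  have hS : ((t / s) * ·) ⁻¹' Ioo 0 t = Ioo 0 s := by
    ext u
    simp only [mem_preimage, mem_Ioo, mul_pos_iff_of_pos_left ha, and_congr_right_iff]
    intro hu
    rw [div_mul_eq_mul_div, div_lt_iff₀ hs, mul_lt_mul_iff_right₀ ht]
  have e : svTilde b t = ∫⁻ u in Ioo 0 s, ENNReal.ofReal (u⁻¹ * b (t / s * u)) := by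
    rw [svTilde, setLIntegral_inv_mul_comp_mul_left hm measurableSet_Ioo ha, hS]
  rw [e]
  exact ⟨setLIntegral_le_of_le (by positivity) (by fun_prop) measurableSet_Ioo fun u hu =>
      ⟨hu.1, (comp_mul_bounds h hs hst hu.1).1⟩,
    setLIntegral_le_of_le (by positivity) (by fun_prop) measurableSet_Ioo fun u hu =>
      ⟨hu.1, (comp_mul_bounds h hs hst hu.1).2⟩⟩

lemma svHat_toReal (hb : IsSlowlyVarying b)
    (hfin : ∀ᵐ t ∂(volume.restrict (Ioi (0 : ℝ))), svHat b t < ∞) :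
    IsSlowlyVarying (fun t => (svHat b t).toReal) := by
  obtain ⟨K, hK, hle⟩ := hb.exists_le_svHat
  refine isSlowlyVarying_toReal (svHat_anti b).measurable (ne_zero_of_ofReal_le_mul hb hle)
    ((svHat_anti b).ne_top_of_ae hfin) fun ε hε => ?_
  obtain ⟨C, hC, h⟩ := hb.potter hε
  refine ⟨C, hC, fun s t hs hst => ?_⟩
  have ht := hs.trans_le hst
  have hm := hb.1
  have ha : 0 < t / s := by positivity
  have hS : ((t / s) * ·) ⁻¹' Ioi t = Ioi s := by
    ext u
    simp only [mem_preimage, mem_Ioi]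
    rw [div_mul_eq_mul_div, lt_div_iff₀ hs, mul_lt_mul_iff_right₀ ht]
  have e : svHat b t = ∫⁻ u in Ioi s, ENNReal.ofReal (u⁻¹ * b (t / s * u)) := by
    rw [svHat, setLIntegral_inv_mul_comp_mul_left hm measurableSet_Ioi ha, hS]
  rw [e]
  exact ⟨setLIntegral_le_of_le (by positivity) (by fun_prop) measurableSet_Ioi fun u hu =>
      ⟨hs.trans hu, (comp_mul_bounds h hs hst (hs.trans hu)).1⟩,
    setLIntegral_le_of_le (by positivity) (by fun_prop) measurableSet_Ioi fun u hu =>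
      ⟨hs.trans hu, (comp_mul_bounds h hs hst (hs.trans hu)).2⟩⟩

lemma svTildeSup_toReal (hb : IsSlowlyVarying b)
    (hfin : ∀ᵐ t ∂(volume.restrict (Ioi (0 : ℝ))), svTildeSup b t < ∞) :
    IsSlowlyVarying (fun t => (svTildeSup b t).toReal) := by
  obtain ⟨K, hK, hle⟩ := hb.exists_le_svTildeSup
  refine isSlowlyVarying_toReal (svTildeSup_mono b).measurable (ne_zero_of_ofReal_le_mul hb hle)
    ((svTildeSup_mono b).ne_top_of_ae hfin) fun ε hε => ?_
  obtain ⟨C, hC, h⟩ := hb.potter hε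
  refine ⟨max (C * K) 1, by positivity, fun s t hs hst => ?_⟩
  have ht := hs.trans_le hst
  have h1 : 1 ≤ (t / s) ^ ε := Real.one_le_rpow ((one_le_div hs).2 hst) hε.le
  constructor
  · refine (svTildeSup_mono b hst).trans (le_mul_of_one_le_left' ?_)
    rw [ENNReal.one_le_ofReal]
    exact one_le_mul_of_one_le_of_one_le (le_max_right _ _) h1
  · refine essSup_le_of_ae_le _ ?_
    filter_upwards [ae_restrict_mem measurableSet_Ioo] with v hv
    have hu : 0 < v / (t / s) := by have := hv.1; positivity
    have hus : v / (t / s) ≤ s := by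
      rw [div_div_eq_mul_div, div_le_iff₀ ht, mul_comm]
      gcongr
      exact hv.2.le
    have h2 := (comp_mul_bounds h hs hst hu).2
    rw [mul_div_cancel₀ _ (by positivity)] at h2
    calc ENNReal.ofReal (b v)
        ≤ ENNReal.ofReal (C * (t / s) ^ ε) * ENNReal.ofReal (b (v / (t / s))) :=
          ofReal_le_ofReal_mul (by positivity) h2
      _ ≤ ENNReal.ofReal (C * (t / s) ^ ε) * (ENNReal.ofReal K * svTildeSup b s) := by
          gcongr
          exact (hle _ hu).trans (by gcongr; exact svTildeSup_mono b hus)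
      _ = ENNReal.ofReal (C * K * (t / s) ^ ε) * svTildeSup b s := by
          rw [← mul_assoc, ← ENNReal.ofReal_mul (by positivity)]
          congr 2; ring
      _ ≤ _ := by gcongr; exact le_max_left _ _

lemma svHatSup_toReal (hb : IsSlowlyVarying b)
    (hfin : ∀ᵐ t ∂(volume.restrict (Ioi (0 : ℝ))), svHatSup b t < ∞) :
    IsSlowlyVarying (fun t => (svHatSup b t).toReal) := by
  obtain ⟨K, hK, hle⟩ := hb.exists_le_svHatSup
  refine isSlowlyVarying_toReal (svHatSup_anti b).measurable (ne_zero_of_ofReal_le_mul hb hle)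
    ((svHatSup_anti b).ne_top_of_ae hfin) fun ε hε => ?_
  obtain ⟨C, hC, h⟩ := hb.potter hε
  refine ⟨max (C * K) 1, by positivity, fun s t hs hst => ?_⟩
  have ht := hs.trans_le hst
  have h1 : 1 ≤ (t / s) ^ ε := Real.one_le_rpow ((one_le_div hs).2 hst) hε.le
  constructor
  · refine essSup_le_of_ae_le _ ?_
    filter_upwards [ae_restrict_mem measurableSet_Ioi] with v hv
    have hv0 : 0 < v := hs.trans hv
    have hut : t ≤ t / s * v := by
      rw [div_mul_eq_mul_div, le_div_iff₀ hs]
      gcongr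
      exact le_of_lt hv
    calc ENNReal.ofReal (b v)
        ≤ ENNReal.ofReal (C * (t / s) ^ ε) * ENNReal.ofReal (b (t / s * v)) :=
          ofReal_le_ofReal_mul (by positivity) (comp_mul_bounds h hs hst hv0).1
      _ ≤ ENNReal.ofReal (C * (t / s) ^ ε) * (ENNReal.ofReal K * svHatSup b t) := by
          gcongr
          exact (hle _ (by positivity)).trans (by gcongr; exact svHatSup_anti b hut)
      _ = ENNReal.ofReal (C * K * (t / s) ^ ε) * svHatSup b t := by
          rw [← mul_assoc, ← ENNReal.ofReal_mul (by positivity)]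
          congr 2; ring
      _ ≤ _ := by gcongr; exact le_max_left _ _
  · refine (svHatSup_anti b hst).trans (le_mul_of_one_le_left' ?_)
    rw [ENNReal.one_le_ofReal]
    exact one_le_mul_of_one_le_of_one_le (le_max_right _ _) h1

end IsSlowlyVarying

lemma exists_mul_pow_lt_mul_pow {A B q r : ℝ} (hA : 0 < A) (hr : 0 < r) (hrq : r < q) :
    ∃ n : ℕ, B * r ^ n < A * q ^ n := by
  obtain ⟨n, hn⟩ := pow_unbounded_of_one_lt (B / A) ((one_lt_div hr).2 hrq)
  refine ⟨n, ?_⟩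
  rw [div_pow, div_lt_div_iff₀ hA (by positivity)] at hn
  linarith

lemma exists_eventually_le_of_limsup_ne_top {l : Filter ℝ} {F : ℝ → ℝ≥0∞} {b : ℝ → ℝ}
    (h : limsup (fun t => F t / ENNReal.ofReal (b t)) l ≠ ∞) :
    ∃ M : ℝ, 0 < M ∧ ∀ᶠ t in l, 0 < b t → F t ≤ ENNReal.ofReal M * ENNReal.ofReal (b t) := by
  obtain ⟨m, hm, -⟩ := ENNReal.lt_iff_exists_nnreal_btwn.1 h.lt_top
  refine ⟨m + 1, by positivity, ?_⟩
  filter_upwards [eventually_lt_of_limsup_lt hm] with t ht hbt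
  have h0 : ENNReal.ofReal (b t) ≠ 0 := by simpa using hbt
  rw [ENNReal.div_lt_iff (Or.inl h0) (Or.inl ENNReal.ofReal_ne_top)] at ht
  refine ht.le.trans ?_
  gcongr
  rw [← ENNReal.ofReal_coe_nnreal]
  exact ENNReal.ofReal_le_ofReal (by linarith)

/-- Ratio by which an integral increases over one dyadic step, in real numbers. -/
lemma ratio_le_of_add_le {x y I : ℝ≥0∞} {K : ℝ} (hK : 0 < K) (hy : y ≠ ∞) (hadd : x + I ≤ y)
    (hx : x ≤ ENNReal.ofReal K * I) : (1 + K⁻¹) * x.toReal ≤ y.toReal := by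
  have hxt : x ≠ ∞ := ne_top_of_le_ne_top hy (le_self_add.trans hadd)
  have hIt : I ≠ ∞ := ne_top_of_le_ne_top hy (le_add_self.trans hadd)
  have h1 : x.toReal + I.toReal ≤ y.toReal := by
    rw [← ENNReal.toReal_add hxt hIt]
    exact ENNReal.toReal_mono hy hadd
  have h2 : x.toReal ≤ K * I.toReal := by
    simpa [hK.le] using
      ENNReal.toReal_mono (ENNReal.mul_ne_top ENNReal.ofReal_ne_top hIt) hx
  rw [← inv_mul_le_iff₀ hK] at h2
  linarith

lemma toReal_le_of_le_ofReal_mul {x : ℝ≥0∞} {M y : ℝ} (hM : 0 < M) (hy : 0 < y)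
    (h : x ≤ ENNReal.ofReal M * ENNReal.ofReal y) : x ≠ ∞ ∧ x.toReal ≤ M * y := by
  have ht : ENNReal.ofReal M * ENNReal.ofReal y ≠ ∞ :=
    ENNReal.mul_ne_top ENNReal.ofReal_ne_top ENNReal.ofReal_ne_top
  exact ⟨ne_top_of_le_ne_top ht h, by simpa [hM.le, hy.le] using ENNReal.toReal_mono ht h⟩

lemma le_toReal_of_ofReal_le_mul {x : ℝ≥0∞} {M y : ℝ} (hM : 0 < M) (hy : 0 < y) (hx : x ≠ ∞)
    (h : ENNReal.ofReal y ≤ ENNReal.ofReal M * x) : y ≤ M * x.toReal := by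
  simpa [hM.le, hy.le] using
    ENNReal.toReal_mono (ENNReal.mul_ne_top ENNReal.ofReal_ne_top hx) h

lemma svTilde_add_le (b : ℝ → ℝ) {t : ℝ} (ht : 0 < t) :
    svTilde b t + ∫⁻ s in Ioo t (2 * t), ENNReal.ofReal (s⁻¹ * b s) ≤ svTilde b (2 * t) := by
  rw [svTilde, ← lintegral_union measurableSet_Ioo]
  · exact lintegral_mono_set (union_subset (Ioo_subset_Ioo_right (by linarith))
      (Ioo_subset_Ioo_left ht.le))
  · exact disjoint_left.2 fun s hs hs' => (hs.2.trans hs'.1).false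

lemma svHat_add_le (b : ℝ → ℝ) {t : ℝ} (ht : 0 < t) :
    svHat b (2 * t) + ∫⁻ s in Ioo t (2 * t), ENNReal.ofReal (s⁻¹ * b s) ≤ svHat b t := by
  rw [svHat, ← lintegral_union measurableSet_Ioo]
  · exact lintegral_mono_set (union_subset (Ioi_subset_Ioi (by linarith)) Ioo_subset_Ioi_self)
  · exact disjoint_left.2 fun s hs hs' => (hs'.2.trans hs).false

namespace IsSlowlyVarying

variable {b : ℝ → ℝ}

/-- Geometric growth along a dyadic sequence contradicts slow variation. -/
lemma not_growth (hb : IsSlowlyVarying b) {x : ℕ → ℝ} (hx : ∀ n, 0 < x n)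
    (hx2 : (∀ n, x n = x 0 * 2 ^ n) ∨ ∀ n, x 0 = x n * 2 ^ n) {G I : ℕ → ℝ≥0∞} {K M : ℝ}
    (hK : 0 < K) (hM : 0 < M) (hG0 : G 0 ≠ 0)
    (hGM : ∀ n, G n ≤ ENNReal.ofReal M * ENNReal.ofReal (b (x n)))
    (hadd : ∀ n, G n + I n ≤ G (n + 1)) (hI : ∀ n, G n ≤ ENNReal.ofReal K * I n) : False := by
  have hbx := fun n => hb.2.1 _ (hx n)
  have hG := fun n => toReal_le_of_le_ofReal_mul hM (hbx n) (hGM n)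
  have hq : 1 < 1 + K⁻¹ := lt_add_of_pos_right _ (by positivity)
  obtain ⟨r, hr1, hrq⟩ := exists_between hq
  obtain ⟨C, hC, h⟩ := hb.exists_geometric hr1
  have hstep : ∀ n, (1 + K⁻¹) ^ n * (G 0).toReal ≤ (G n).toReal := fun n => by
    induction n with
    | zero => simp
    | succ n ih =>
      calc (1 + K⁻¹) ^ (n + 1) * (G 0).toReal = (1 + K⁻¹) * ((1 + K⁻¹) ^ n * (G 0).toReal) := by
            ring
        _ ≤ (1 + K⁻¹) * (G n).toReal := by gcongr
        _ ≤ _ := ratio_le_of_add_le hK (hG (n + 1)).1 (hadd n) (hI n)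
  have hbn : ∀ n, b (x n) ≤ C * r ^ n * b (x 0) := fun n => by
    rcases hx2 with h2 | h2
    · have := (h n (x 0) (hx 0)).2
      rwa [← h2 n] at this
    · have := (h n (x n) (hx n)).1
      rwa [← h2 n] at this
  obtain ⟨n, hn⟩ := exists_mul_pow_lt_mul_pow (B := M * C * b (x 0))
    (ENNReal.toReal_pos hG0 (hG 0).1) (by linarith) hrq
  have h3 : M * b (x n) ≤ M * (C * r ^ n * b (x 0)) := by gcongr; exact hbn n
  linarith [hstep n, (hG n).2]

/-- Geometric decay along a dyadic sequence contradicts slow variation. -/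
lemma not_decay (hb : IsSlowlyVarying b) {x : ℕ → ℝ} (hx : ∀ n, 0 < x n)
    (hx2 : (∀ n, x n = x 0 * 2 ^ n) ∨ ∀ n, x 0 = x n * 2 ^ n) {G I : ℕ → ℝ≥0∞} {K L : ℝ}
    (hK : 0 < K) (hL : 0 < L) (hGt : ∀ n, G n ≠ ∞)
    (hGL : ∀ n, ENNReal.ofReal (b (x n)) ≤ ENNReal.ofReal L * G n)
    (hadd : ∀ n, G (n + 1) + I n ≤ G n) (hI : ∀ n, G (n + 1) ≤ ENNReal.ofReal K * I n) :
    False := by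
  have hbx := fun n => hb.2.1 _ (hx n)
  have hq : 1 < 1 + K⁻¹ := lt_add_of_pos_right _ (by positivity)
  obtain ⟨r, hr1, hrq⟩ := exists_between hq
  have hr0 : 0 < r := by linarith
  obtain ⟨C, hC, h⟩ := hb.exists_geometric hr1
  have hstep : ∀ n, (1 + K⁻¹) ^ n * (G n).toReal ≤ (G 0).toReal := fun n => by
    induction n with
    | zero => simp
    | succ n ih =>
      calc (1 + K⁻¹) ^ (n + 1) * (G (n + 1)).toReal
          = (1 + K⁻¹) ^ n * ((1 + K⁻¹) * (G (n + 1)).toReal) := by ring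
        _ ≤ (1 + K⁻¹) ^ n * (G n).toReal := by
            gcongr
            exact ratio_le_of_add_le hK (hGt n) (hadd n) (hI n)
        _ ≤ _ := ih
  have hbn : ∀ n, b (x 0) ≤ C * r ^ n * b (x n) := fun n => by
    rcases hx2 with h2 | h2
    · have := (h n (x 0) (hx 0)).1
      rwa [← h2 n] at this
    · have := (h n (x n) (hx n)).2
      rwa [← h2 n] at this
  obtain ⟨n, hn⟩ := exists_mul_pow_lt_mul_pow (B := C * L * (G 0).toReal) (hbx 0) hr0 hrq
  refine hn.not_ge ?_
  calc b (x 0) * (1 + K⁻¹) ^ n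
      ≤ C * r ^ n * (L * (G n).toReal) * (1 + K⁻¹) ^ n := by
        gcongr
        refine (hbn n).trans ?_
        gcongr
        exact le_toReal_of_ofReal_le_mul hL (hbx n) (hGt n) (hGL n)
    _ = C * L * r ^ n * ((1 + K⁻¹) ^ n * (G n).toReal) := by ring
    _ ≤ C * L * r ^ n * (G 0).toReal := by gcongr; exact hstep n
    _ = _ := by ring

lemma limsup_svTilde_atTop (hb : IsSlowlyVarying b) :
    limsup (fun t => svTilde b t / ENNReal.ofReal (b t)) atTop = ∞ := by
  by_contra hne
  obtain ⟨M, hM, hev⟩ := exists_eventually_le_of_limsup_ne_top hne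
  obtain ⟨T, hT⟩ := eventually_atTop.1 (hev.and (eventually_gt_atTop 0))
  have hT0 : 0 < T := (hT T le_rfl).2
  have hle : ∀ t, T ≤ t → svTilde b t ≤ ENNReal.ofReal M * ENNReal.ofReal (b t) :=
    fun t ht => (hT t ht).1 (hb.2.1 t (hT0.trans_le ht))
  obtain ⟨L, -, hL⟩ := hb.exists_le_svTilde
  have hTx : ∀ n : ℕ, T ≤ T * 2 ^ n := fun n =>
    le_mul_of_one_le_right hT0.le (one_le_pow₀ one_le_two)
  refine hb.not_growth (x := fun n => T * 2 ^ n) (G := fun n => svTilde b (T * 2 ^ n))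
    (I := fun n => ∫⁻ s in Ioo (T * 2 ^ n) (2 * (T * 2 ^ n)), ENNReal.ofReal (s⁻¹ * b s))
    (K := 2 * M) (M := M) (fun n => by positivity) (Or.inl fun n => by simp) (by positivity) hM
    (ne_zero_of_ofReal_le_mul hb hL _ (by positivity)) (fun n => hle _ (hTx n)) (fun n => ?_)
    fun n => ?_
  · rw [show T * 2 ^ (n + 1) = 2 * (T * 2 ^ n) by ring]
    exact svTilde_add_le b (by positivity)
  · exact le_mul_setLIntegral_Ioo (by positivity) hM hb.1 fun s hs =>
      (svTilde_mono b hs.1.le).trans (hle s ((hTx n).trans hs.1.le))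

lemma limsup_svHat_atTop (hb : IsSlowlyVarying b) :
    limsup (fun t => svHat b t / ENNReal.ofReal (b t)) atTop = ∞ := by
  by_contra hne
  obtain ⟨M, hM, hev⟩ := exists_eventually_le_of_limsup_ne_top hne
  obtain ⟨T, hT⟩ := eventually_atTop.1 (hev.and (eventually_gt_atTop 0))
  have hT0 : 0 < T := (hT T le_rfl).2
  have hle : ∀ t, T ≤ t → svHat b t ≤ ENNReal.ofReal M * ENNReal.ofReal (b t) :=
    fun t ht => (hT t ht).1 (hb.2.1 t (hT0.trans_le ht))
  obtain ⟨L, hL0, hL⟩ := hb.exists_le_svHat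
  have hTx : ∀ n : ℕ, T ≤ T * 2 ^ n := fun n =>
    le_mul_of_one_le_right hT0.le (one_le_pow₀ one_le_two)
  refine hb.not_decay (x := fun n => T * 2 ^ n) (G := fun n => svHat b (T * 2 ^ n))
    (I := fun n => ∫⁻ s in Ioo (T * 2 ^ n) (2 * (T * 2 ^ n)), ENNReal.ofReal (s⁻¹ * b s))
    (K := 2 * M) (L := L) (fun n => by positivity) (Or.inl fun n => by simp) (by positivity) hL0
    (fun n => (toReal_le_of_le_ofReal_mul hM (hb.2.1 _ (hT0.trans_le (hTx n)))
      (hle _ (hTx n))).1)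
    (fun n => hL _ (by positivity)) (fun n => ?_) fun n => ?_
  · rw [show T * 2 ^ (n + 1) = 2 * (T * 2 ^ n) by ring]
    exact svHat_add_le b (by positivity)
  · rw [show T * 2 ^ (n + 1) = 2 * (T * 2 ^ n) by ring]
    exact le_mul_setLIntegral_Ioo (by positivity) hM hb.1 fun s hs =>
      (svHat_anti b hs.2.le).trans (hle s ((hTx n).trans hs.1.le))

lemma limsup_svTilde_nhdsGT (hb : IsSlowlyVarying b) :
    limsup (fun t => svTilde b t / ENNReal.ofReal (b t)) (𝓝[>] 0) = ∞ := by
  by_contra hne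
  obtain ⟨M, hM, hev⟩ := exists_eventually_le_of_limsup_ne_top hne
  obtain ⟨T, hT0, hT⟩ := mem_nhdsGT_iff_exists_Ioc_subset.1 hev
  rw [mem_Ioi] at hT0
  have hle : ∀ t, 0 < t → t ≤ T → svTilde b t ≤ ENNReal.ofReal M * ENNReal.ofReal (b t) :=
    fun t ht htT => hT ⟨ht, htT⟩ (hb.2.1 t ht)
  obtain ⟨L, hL0, hL⟩ := hb.exists_le_svTilde
  have hTx : ∀ n : ℕ, T / 2 ^ n ≤ T := fun n => div_le_self hT0.le (one_le_pow₀ one_le_two)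
  have hx2 : ∀ n : ℕ, T / 2 ^ n = 2 * (T / 2 ^ (n + 1)) := fun n => by
    rw [pow_succ]; field_simp
  refine hb.not_decay (x := fun n => T / 2 ^ n) (G := fun n => svTilde b (T / 2 ^ n))
    (I := fun n => ∫⁻ s in Ioo (T / 2 ^ (n + 1)) (2 * (T / 2 ^ (n + 1))),
      ENNReal.ofReal (s⁻¹ * b s))
    (K := 2 * M) (L := L) (fun n => by positivity) (Or.inr fun n => by simp) (by positivity) hL0
    (fun n => (toReal_le_of_le_ofReal_mul hM (hb.2.1 _ (by simp only [mem_Ioi]; positivity))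
      (hle _ (by positivity) (hTx n))).1)
    (fun n => hL _ (by positivity)) (fun n => ?_) fun n => ?_
  · rw [hx2 n]
    exact svTilde_add_le b (by positivity)
  · refine le_mul_setLIntegral_Ioo (by positivity) hM hb.1 fun s hs => ?_
    have hs0 : 0 < T / 2 ^ (n + 1) := by positivity
    rw [← hx2 n] at hs
    exact (svTilde_mono b hs.1.le).trans (hle s (hs0.trans hs.1) (hs.2.le.trans (hTx n)))

lemma limsup_svHat_nhdsGT (hb : IsSlowlyVarying b) :
    limsup (fun t => svHat b t / ENNReal.ofReal (b t)) (𝓝[>] 0) = ∞ := by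
  by_contra hne
  obtain ⟨M, hM, hev⟩ := exists_eventually_le_of_limsup_ne_top hne
  obtain ⟨T, hT0, hT⟩ := mem_nhdsGT_iff_exists_Ioc_subset.1 hev
  rw [mem_Ioi] at hT0
  have hle : ∀ t, 0 < t → t ≤ T → svHat b t ≤ ENNReal.ofReal M * ENNReal.ofReal (b t) :=
    fun t ht htT => hT ⟨ht, htT⟩ (hb.2.1 t ht)
  obtain ⟨L, -, hL⟩ := hb.exists_le_svHat
  have hTx : ∀ n : ℕ, T / 2 ^ n ≤ T := fun n => div_le_self hT0.le (one_le_pow₀ one_le_two)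
  have hx2 : ∀ n : ℕ, T / 2 ^ n = 2 * (T / 2 ^ (n + 1)) := fun n => by
    rw [pow_succ]; field_simp
  refine hb.not_growth (x := fun n => T / 2 ^ n) (G := fun n => svHat b (T / 2 ^ n))
    (I := fun n => ∫⁻ s in Ioo (T / 2 ^ (n + 1)) (2 * (T / 2 ^ (n + 1))),
      ENNReal.ofReal (s⁻¹ * b s))
    (K := 2 * M) (M := M) (fun n => by positivity) (Or.inr fun n => by simp) (by positivity) hM
    (ne_zero_of_ofReal_le_mul hb hL _ (by positivity))
    (fun n => hle _ (by positivity) (hTx n)) (fun n => ?_) fun n => ?_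
  · rw [hx2 n]
    exact svHat_add_le b (by positivity)
  · refine le_mul_setLIntegral_Ioo (by positivity) hM hb.1 fun s hs => ?_
    have hs0 : 0 < T / 2 ^ (n + 1) := by positivity
    rw [← hx2 n] at hs
    exact (svHat_anti b hs.2.le).trans (hle s (hs0.trans hs.1) (hs.2.le.trans (hTx n)))

end IsSlowlyVarying

/-- Lemma LSV, (SV6): the functions `b̃`, `b̃_∞`, `b̂`, `b̂_∞`. -/
theorem lsv_tilde_hat (b : ℝ → ℝ) (hb : IsSlowlyVarying b) :
    ((∃ C : ℝ≥0∞, C < ∞ ∧ ∀ t ∈ Set.Ioi (0:ℝ), ENNReal.ofReal (b t) ≤ C * svTilde b t) ∧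
     (∃ C : ℝ≥0∞, C < ∞ ∧ ∀ t ∈ Set.Ioi (0:ℝ), ENNReal.ofReal (b t) ≤ C * svTildeSup b t) ∧
     (∃ C : ℝ≥0∞, C < ∞ ∧ ∀ t ∈ Set.Ioi (0:ℝ), ENNReal.ofReal (b t) ≤ C * svHat b t) ∧
     (∃ C : ℝ≥0∞, C < ∞ ∧ ∀ t ∈ Set.Ioi (0:ℝ), ENNReal.ofReal (b t) ≤ C * svHatSup b t)) ∧
    ((IsSlowlyVarying (fun t => (svTilde b t).toReal) ↔
        ∀ᵐ t ∂(volume.restrict (Set.Ioi (0:ℝ))), svTilde b t < ∞) ∧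
     (IsSlowlyVarying (fun t => (svTildeSup b t).toReal) ↔
        ∀ᵐ t ∂(volume.restrict (Set.Ioi (0:ℝ))), svTildeSup b t < ∞) ∧
     (IsSlowlyVarying (fun t => (svHat b t).toReal) ↔
        ∀ᵐ t ∂(volume.restrict (Set.Ioi (0:ℝ))), svHat b t < ∞) ∧
     (IsSlowlyVarying (fun t => (svHatSup b t).toReal) ↔
        ∀ᵐ t ∂(volume.restrict (Set.Ioi (0:ℝ))), svHatSup b t < ∞)) ∧
    (Filter.limsup (fun t => svTilde b t / ENNReal.ofReal (b t))
        (nhdsWithin (0:ℝ) (Set.Ioi 0)) = ∞ ∧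
     Filter.limsup (fun t => svTilde b t / ENNReal.ofReal (b t)) Filter.atTop = ∞ ∧
     Filter.limsup (fun t => svHat b t / ENNReal.ofReal (b t))
        (nhdsWithin (0:ℝ) (Set.Ioi 0)) = ∞ ∧
     Filter.limsup (fun t => svHat b t / ENNReal.ofReal (b t)) Filter.atTop = ∞) := by
  have bound : ∀ {F : ℝ → ℝ≥0∞},
      (∃ C : ℝ, 0 < C ∧ ∀ t, 0 < t → ENNReal.ofReal (b t) ≤ ENNReal.ofReal C * F t) →
      ∃ C : ℝ≥0∞, C < ∞ ∧ ∀ t ∈ Set.Ioi (0 : ℝ), ENNReal.ofReal (b t) ≤ C * F t :=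
    fun ⟨C, _, h⟩ => ⟨ENNReal.ofReal C, ENNReal.ofReal_lt_top, h⟩
  exact ⟨⟨bound hb.exists_le_svTilde, bound hb.exists_le_svTildeSup, bound hb.exists_le_svHat,
      bound hb.exists_le_svHatSup⟩,
    ⟨⟨IsSlowlyVarying.lt_top, hb.svTilde_toReal⟩, ⟨IsSlowlyVarying.lt_top, hb.svTildeSup_toReal⟩,
      ⟨IsSlowlyVarying.lt_top, hb.svHat_toReal⟩, ⟨IsSlowlyVarying.lt_top, hb.svHatSup_toReal⟩⟩,
    hb.limsup_svTilde_nhdsGT, hb.limsup_svTilde_atTop, hb.limsup_svHat_nhdsGT,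
    hb.limsup_svHat_atTop⟩
end

section
/- Let p, q ∈ (0,∞] and let b be slowly varying. Then ‖·‖_{p,q,b} is a rearrangement-invariant quasi-Banach function norm (and consequently L^{p,q,b} is an r.i. quasi-Banach function space) if and only if p < ∞, or p = ∞ and ‖ t^{−1/q} b(t) χ_{(0,1)}(t) ‖_{L^q(0,∞)} < ∞. Furthermore, if these conditions are not satisfied, then L^{p,q,b} = {0}. -/
open MeasureTheory Set Filter ENNReal Topology

section LqNorm

lemma lqNorm_eq_eLpNorm {q : ℝ≥0∞} (hq : q ≠ 0) (S : Set ℝ) (g : ℝ → ℝ≥0∞) :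
    lqNorm q S g = eLpNorm g q (volume.restrict S) := by
  unfold lqNorm
  split_ifs with h
  · subst h
    simp [eLpNorm_exponent_top, eLpNormEssSup]
  · rw [eLpNorm_eq_lintegral_rpow_enorm_toReal hq h]
    simp

/-- Monotone convergence for the `L^q` functional, including `q = ∞`. -/
lemma eLpNorm_iSup_of_monotone {α : Type*} [MeasurableSpace α] {ν : Measure α} (q : ℝ≥0∞)
    {g : ℕ → α → ℝ≥0∞} (hg : ∀ n, Measurable (g n)) (hmono : Monotone g) :
    eLpNorm (fun t => ⨆ n, g n t) q ν = ⨆ n, eLpNorm (g n) q ν := by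
  refine le_antisymm ?_ (iSup_le fun n => eLpNorm_mono_enorm fun t => ?_)
  · by_cases h0 : q = 0
    · simp [h0]
    by_cases h : q = ∞
    · subst h
      simp only [eLpNorm_exponent_top, eLpNormEssSup, enorm_eq_self]
      refine essSup_le_of_ae_le _ ?_
      have : ∀ᵐ t ∂ν, ∀ n, g n t ≤ essSup (g n) ν :=
        ae_all_iff.2 fun n => ENNReal.ae_le_essSup (g n)
      filter_upwards [this] with t ht
      exact iSup_mono ht
    · have hq : 0 < q.toReal := ENNReal.toReal_pos h0 h
      have rpow_iSup : ∀ (r : ℝ), 0 < r → ∀ u : ℕ → ℝ≥0∞, (⨆ n, u n) ^ r = ⨆ n, u n ^ r :=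
        fun r hr u => (ENNReal.orderIsoRpow r hr).map_iSup u
      simp only [eLpNorm_eq_lintegral_rpow_enorm_toReal h0 h, enorm_eq_self, rpow_iSup _ hq]
      rw [lintegral_iSup (fun n => (hg n).pow_const _)
        (fun m n hmn t => ENNReal.rpow_le_rpow (hmono hmn t) hq.le), rpow_iSup _ (by positivity)]
  · simpa using le_iSup (fun n => g n t) n

/-- Dilation by `1/2` is bounded on `L^q(0,∞)`. -/
lemma eLpNorm_comp_half_le {q : ℝ≥0∞} {g : ℝ → ℝ≥0∞} (hg : Measurable g) :
    eLpNorm (fun t => g (2⁻¹ * t)) q (volume.restrict (Ioi 0)) ≤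
      2 ^ (1 / q).toReal * eLpNorm g q (volume.restrict (Ioi 0)) := by
  have hm : Measurable fun t : ℝ => 2⁻¹ * t := measurable_const_mul _
  have hpre : (fun t : ℝ => 2⁻¹ * t) ⁻¹' Ioi 0 = Ioi 0 := by
    ext t; simp
  have hmap : Measure.map (fun t : ℝ => 2⁻¹ * t) (volume.restrict (Ioi 0)) =
      (2 : ℝ≥0∞) • volume.restrict (Ioi (0 : ℝ)) := by
    have h := Measure.restrict_map (μ := volume) hm (measurableSet_Ioi (a := (0 : ℝ)))
    rw [hpre, Real.map_volume_mul_left (by norm_num)] at h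
    rw [← h, Measure.restrict_smul]
    norm_num
  have h := eLpNorm_map_measure (p := q) (μ := volume.restrict (Ioi (0 : ℝ)))
    (f := fun t : ℝ => 2⁻¹ * t) hg.aestronglyMeasurable hm.aemeasurable
  rw [hmap, eLpNorm_smul_measure_of_ne_zero two_ne_zero] at h
  exact h.symm.le

/-- A function dominated by a finite constant has finite `L^q` norm on a set of finite measure. -/
lemma eLpNorm_restrict_lt_top_of_le {q : ℝ≥0∞} {S : Set ℝ} (hS : MeasurableSet S)
    (hfin : volume S ≠ ∞) {w : ℝ → ℝ≥0∞} {M : ℝ≥0∞} (hM : M ≠ ∞) (h : ∀ t ∈ S, w t ≤ M) :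
    eLpNorm w q (volume.restrict S) < ∞ := by
  by_cases h0 : q = 0
  · simp [h0]
  have hle : eLpNorm w q (volume.restrict S) ≤ eLpNorm (fun _ => M) q (volume.restrict S) := by
    refine eLpNorm_mono_enorm_ae ?_
    filter_upwards [ae_restrict_mem hS] with t ht
    simpa using h t ht
  refine hle.trans_lt ?_
  by_cases hz : volume.restrict S = 0
  · simp [hz]
  rw [eLpNorm_const _ h0 hz]
  refine ENNReal.mul_lt_top (by simpa using hM.lt_top) ?_
  exact ENNReal.rpow_lt_top_of_nonneg (by positivity) (by simpa using hfin)

lemma eLpNorm_restrict_union_lt_top {q : ℝ≥0∞} {S T : Set ℝ} (hS : MeasurableSet S)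
    (hT : MeasurableSet T) {w : ℝ → ℝ≥0∞} (hw : Measurable w)
    (h1 : eLpNorm w q (volume.restrict S) < ∞) (h2 : eLpNorm w q (volume.restrict T) < ∞) :
    eLpNorm w q (volume.restrict (S ∪ T)) < ∞ := by
  rw [← eLpNorm_indicator_eq_eLpNorm_restrict hS] at h1
  rw [← eLpNorm_indicator_eq_eLpNorm_restrict hT] at h2
  rw [← eLpNorm_indicator_eq_eLpNorm_restrict (hS.union hT)]
  refine lt_of_le_of_lt (eLpNorm_mono_enorm fun t => ?_)
    (eLpNorm_add_lt_top (⟨(hw.indicator hS).aestronglyMeasurable, h1⟩ : MemLp _ q volume)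
      ⟨(hw.indicator hT).aestronglyMeasurable, h2⟩)
  by_cases a : t ∈ S <;> by_cases c : t ∈ T <;> simp [a, c]

end LqNorm

section Rearrangement

variable {X : Type*} [MeasurableSpace X] {μ : Measure X}

lemma rearr_le_iff {f : X → ℝ} {t : ℝ} {s : ℝ≥0∞} :
    rearr μ f t ≤ s ↔ μ {x | s < ENNReal.ofReal |f x|} ≤ ENNReal.ofReal t := by
  refine ⟨fun h => ?_, fun h => sInf_le h⟩
  by_cases hs : s = ∞
  · simp [hs]
  obtain ⟨u, hu, hsu, hlim⟩ := exists_seq_strictAnti_tendsto' (lt_top_iff_ne_top.2 hs)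
  have hset : {x | s < ENNReal.ofReal |f x|} = ⋃ n, {x | u n < ENNReal.ofReal |f x|} := by
    ext x
    simp only [mem_ofPred_eq, mem_iUnion]
    exact ⟨fun hx => (hlim.eventually (gt_mem_nhds hx)).exists,
      fun ⟨n, hn⟩ => (hsu n).1.trans hn⟩
  have hmono : Monotone fun n => {x | u n < ENNReal.ofReal |f x|} :=
    fun m n hmn x hx => lt_of_le_of_lt (hu.antitone hmn) hx
  rw [hset, hmono.measure_iUnion]
  refine iSup_le fun n => ?_
  obtain ⟨r, hr, hrn⟩ := sInf_lt_iff.1 (lt_of_le_of_lt h (hsu n).1)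
  exact (measure_mono fun x hx => lt_trans hrn hx).trans hr

lemma rearr_antitone (f : X → ℝ) : Antitone (rearr μ f) := fun _ _ h =>
  rearr_le_iff.2 ((rearr_le_iff.1 le_rfl).trans (ENNReal.ofReal_le_ofReal h))

lemma rearr_measurable (f : X → ℝ) : Measurable (rearr μ f) :=
  (rearr_antitone f).measurable

lemma rearr_mono {f g : X → ℝ} (h : ∀ᵐ x ∂μ, |f x| ≤ |g x|) (t : ℝ) :
    rearr μ f t ≤ rearr μ g t := by
  refine rearr_le_iff.2 (le_trans (measure_mono_ae ?_) (rearr_le_iff.1 (le_refl (rearr μ g t))))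
  filter_upwards [h] with x hx hfx
  exact lt_of_lt_of_le (show _ < ENNReal.ofReal |f x| from hfx) (ENNReal.ofReal_le_ofReal hx)

lemma rearr_const_mul_le (a : ℝ) (f : X → ℝ) (t : ℝ) :
    rearr μ (fun x => a * f x) t ≤ ENNReal.ofReal |a| * rearr μ f t := by
  refine rearr_le_iff.2 (le_trans (measure_mono fun x hx => ?_) (rearr_le_iff.1 (le_refl (rearr μ f t))))
  simp only [mem_ofPred_eq, abs_mul, ENNReal.ofReal_mul (abs_nonneg a)] at hx ⊢
  exact lt_of_mul_lt_mul_left' hx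

lemma rearr_add_le (f g : X → ℝ) {s t : ℝ} (hs : 0 ≤ s) (ht : 0 ≤ t) :
    rearr μ (fun x => f x + g x) (s + t) ≤ rearr μ f s + rearr μ g t := by
  rw [rearr_le_iff, ENNReal.ofReal_add hs ht]
  refine le_trans (measure_mono fun x hx => ?_) ((measure_union_le _ _).trans
    (add_le_add (rearr_le_iff.1 (le_refl (rearr μ f s))) (rearr_le_iff.1 (le_refl (rearr μ g t)))))
  by_contra hcon
  simp only [mem_union, mem_ofPred_eq, not_or, not_lt] at hcon hx
  refine hx.not_ge (le_trans ?_ (add_le_add hcon.1 hcon.2))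
  rw [← ENNReal.ofReal_add (abs_nonneg _) (abs_nonneg _)]
  exact ENNReal.ofReal_le_ofReal (abs_add_le _ _)

lemma rearr_eq_iSup {f : ℕ → X → ℝ} {g : X → ℝ}
    (h0 : ∀ᵐ x ∂μ, ∀ n, 0 ≤ f n x) (hmono : ∀ᵐ x ∂μ, Monotone fun n => f n x)
    (hlim : ∀ᵐ x ∂μ, Tendsto (fun n => f n x) atTop (𝓝 (g x))) (t : ℝ) :
    rearr μ g t = ⨆ n, rearr μ (f n) t := by
  refine le_antisymm (rearr_le_iff.2 ?_) (iSup_le fun n => rearr_mono ?_ t)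
  · set s := ⨆ n, rearr μ (f n) t
    let A : ℕ → Set X := fun n => {x | s < ENNReal.ofReal |f n x|}
    have h1 : μ {x | s < ENNReal.ofReal |g x|} ≤ μ (⋃ n, A n) := by
      refine measure_mono_ae ?_
      filter_upwards [hlim] with x hx hgx
      have hc : Tendsto (fun n => ENNReal.ofReal |f n x|) atTop (𝓝 (ENNReal.ofReal |g x|)) :=
        ENNReal.tendsto_ofReal hx.abs
      exact mem_iUnion.2 (hc.eventually (lt_mem_nhds hgx)).exists
    refine h1.trans ?_
    rw [measure_iUnion_eq_iSup_accumulate]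
    refine iSup_le fun n => ?_
    refine le_trans (measure_mono_ae ?_)
      (rearr_le_iff.1 (le_iSup (fun n => rearr μ (f n) t) n))
    filter_upwards [h0, hmono] with x hx0 hx hxA
    obtain ⟨m, hmn, hm⟩ := mem_accumulate.1 hxA
    refine lt_of_lt_of_le hm (ENNReal.ofReal_le_ofReal ?_)
    rw [abs_of_nonneg (hx0 m), abs_of_nonneg (hx0 n)]
    exact hx hmn
  · filter_upwards [h0, hmono, hlim] with x hx0 hx hxl
    have hle := hx.ge_of_tendsto hxl n
    rwa [abs_of_nonneg (hx0 n), abs_of_nonneg ((hx0 n).trans hle)]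

lemma rearr_eq_zero_of_ae_eq_zero {f : X → ℝ} (h : f =ᵐ[μ] 0) (t : ℝ) : rearr μ f t = 0 := by
  refine le_antisymm (rearr_le_iff.2 (le_of_eq_of_le ?_ zero_le)) zero_le
  refine measure_mono_null_ae ?_ (measure_empty (μ := μ))
  filter_upwards [h] with x hx hfx
  have : (0 : ℝ≥0∞) < ENNReal.ofReal |f x| := hfx
  simp [hx] at this

lemma ae_eq_zero_of_rearr_eq_zero {f : X → ℝ} (h : ∀ t > 0, rearr μ f t = 0) : f =ᵐ[μ] 0 := by
  have h0 : μ {x | 0 < ENNReal.ofReal |f x|} ≤ 0 := by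
    refine ENNReal.le_of_forall_pos_le_add fun ε hε _ => ?_
    have := rearr_le_iff.1 (h ε hε).le
    simpa using this
  refine (ae_iff.2 (le_antisymm (le_trans (measure_mono fun x hx => ?_) h0) zero_le))
  simpa using hx

lemma rearr_indicator_le {E : Set X} (hE : μ E < ∞) {t : ℝ} (ht : 0 < t) :
    rearr μ (E.indicator fun _ => (1 : ℝ)) t ≤ (Ioo 0 (μ E).toReal).indicator 1 t := by
  by_cases h : t < (μ E).toReal
  · rw [indicator_of_mem (show t ∈ Ioo 0 (μ E).toReal from ⟨ht, h⟩), rearr_le_iff]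
    refine le_of_eq_of_le ?_ zero_le
    convert measure_empty (μ := μ)
    ext x
    by_cases hx : x ∈ E <;> simp [hx]
  · rw [indicator_of_notMem (fun hm => h hm.2), rearr_le_iff]
    refine le_trans (measure_mono fun x hx => ?_)
      ((ENNReal.le_ofReal_iff_toReal_le hE.ne ht.le).2 (not_lt.1 h))
    by_contra hxE
    simp [hxE] at hx

end Rearrangement

section SlowlyVarying

variable {b : ℝ → ℝ}

/-- A slowly varying function is doubling. -/
lemma IsSlowlyVarying.exists_two_mul_le (hb : IsSlowlyVarying b) :
    ∃ K : ℝ, 0 < K ∧ ∀ t > 0, b (2 * t) ≤ K * b t := by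
  obtain ⟨bm, hanti, c, C, hc, hC, h⟩ := (hb.2.2 1 one_pos).2
  refine ⟨2 * (C / c), by positivity, fun t ht => ?_⟩
  have h2t : (0 : ℝ) < 2 * t := by positivity
  have e1 := (h (2 * t) h2t).2
  have e2 := (h t ht).1
  have e3 : bm (2 * t) ≤ bm t := hanti ht h2t (by linarith)
  simp only [Real.rpow_neg_one] at e1 e2
  have e4 : (2 * t)⁻¹ * b (2 * t) ≤ C * (c⁻¹ * (t⁻¹ * b t)) := by
    refine e1.trans (mul_le_mul_of_nonneg_left (e3.trans ?_) hC.le)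
    rw [inv_mul_eq_div, le_div_iff₀ hc]
    linarith
  rw [inv_mul_le_iff₀ h2t] at e4
  refine e4.trans (le_of_eq ?_)
  field_simp

lemma IsSlowlyVarying.exists_le_rpow (hb : IsSlowlyVarying b) {ε : ℝ} (hε : 0 < ε) {T : ℝ} :
    ∃ M : ℝ, 0 ≤ M ∧ ∀ t, 0 < t → t ≤ T → b t ≤ M * t ^ (-ε) := by
  obtain ⟨bp, hmono, c, C, hc, hC, h⟩ := (hb.2.2 ε hε).1
  refine ⟨|C * bp T|, abs_nonneg _, fun t ht htT => ?_⟩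
  have e1 := (h t ht).2
  have e2 : bp t ≤ bp T := hmono ht (ht.trans_le htT) htT
  have hpos : 0 < t ^ ε := Real.rpow_pos_of_pos ht ε
  rw [Real.rpow_neg ht.le, ← div_eq_mul_inv, le_div_iff₀ hpos, mul_comm]
  exact e1.trans ((mul_le_mul_of_nonneg_left e2 hC.le).trans (le_abs_self _))

/-- The weight of the Lorentz–Karamata functional, with exponent `α`. -/
noncomputable def lkWeight (α : ℝ) (b : ℝ → ℝ) (t : ℝ) : ℝ≥0∞ := ENNReal.ofReal (t ^ α * b t)

lemma IsSlowlyVarying.measurable_lkWeight (hb : IsSlowlyVarying b) (α : ℝ) :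
    Measurable (lkWeight α b) :=
  ((measurable_id.pow_const α).mul hb.1).ennreal_ofReal

lemma IsSlowlyVarying.lkWeight_pos (hb : IsSlowlyVarying b) (α : ℝ) {t : ℝ} (ht : 0 < t) :
    0 < lkWeight α b t :=
  ENNReal.ofReal_pos.2 (mul_pos (Real.rpow_pos_of_pos ht α) (hb.2.1 t ht))

lemma IsSlowlyVarying.exists_lkWeight_two_mul_le (hb : IsSlowlyVarying b) (α : ℝ) :
    ∃ K : ℝ≥0∞, K < ∞ ∧ ∀ t > 0, lkWeight α b (2 * t) ≤ K * lkWeight α b t := by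
  obtain ⟨K, hK, h⟩ := hb.exists_two_mul_le
  refine ⟨ENNReal.ofReal (2 ^ α * K), ENNReal.ofReal_lt_top, fun t ht => ?_⟩
  rw [lkWeight, lkWeight, ← ENNReal.ofReal_mul (by positivity)]
  refine ENNReal.ofReal_le_ofReal ?_
  rw [Real.mul_rpow two_pos.le ht.le]
  calc (2 : ℝ) ^ α * t ^ α * b (2 * t) ≤ 2 ^ α * t ^ α * (K * b t) :=
        mul_le_mul_of_nonneg_left (h t ht) (by positivity)
    _ = _ := by ring

lemma IsSlowlyVarying.eLpNorm_lkWeight_Icc_lt_top (hb : IsSlowlyVarying b) (α : ℝ) (q : ℝ≥0∞)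
    {s T : ℝ} (hs : 0 < s) : eLpNorm (lkWeight α b) q (volume.restrict (Icc s T)) < ∞ := by
  obtain ⟨M, hM, h⟩ := hb.exists_le_rpow one_pos (T := T)
  have hcont : ContinuousOn (fun t : ℝ => t ^ α * (M * t ^ (-1 : ℝ))) (Icc s T) := fun t ht =>
    ((Real.continuousAt_rpow_const t α (Or.inl (hs.trans_le ht.1).ne')).mul
      (continuousAt_const.mul
        (Real.continuousAt_rpow_const t (-1) (Or.inl (hs.trans_le ht.1).ne')))).continuousWithinAt
  obtain ⟨B, hB⟩ := isCompact_Icc.bddAbove_image hcont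
  refine eLpNorm_restrict_lt_top_of_le measurableSet_Icc (by simp)
    (M := ENNReal.ofReal B) ENNReal.ofReal_ne_top fun t ht => ENNReal.ofReal_le_ofReal ?_
  have htpos := hs.trans_le ht.1
  exact (mul_le_mul_of_nonneg_left (h t htpos ht.2) (by positivity)).trans
    (hB (mem_image_of_mem _ ht))

/-- Enlarging the interval `(0, s)` does not affect the finiteness of the norm of the weight. -/
lemma IsSlowlyVarying.eLpNorm_lkWeight_Ioo_lt_top (hb : IsSlowlyVarying b) {α : ℝ} {q : ℝ≥0∞}
    {s T : ℝ} (hs : 0 < s) (h : eLpNorm (lkWeight α b) q (volume.restrict (Ioo 0 s)) < ∞) :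
    eLpNorm (lkWeight α b) q (volume.restrict (Ioo 0 T)) < ∞ := by
  refine lt_of_le_of_lt (eLpNorm_mono_measure _ (Measure.restrict_mono (fun t ht => ?_) le_rfl))
    (eLpNorm_restrict_union_lt_top measurableSet_Ioo measurableSet_Icc (hb.measurable_lkWeight α) h
      (hb.eLpNorm_lkWeight_Icc_lt_top α q hs (T := T)))
  rcases lt_or_ge t s with hts | hts
  · exact Or.inl ⟨ht.1, hts⟩
  · exact Or.inr ⟨hts, ht.2.le⟩

lemma IsSlowlyVarying.eLpNorm_lkWeight_lt_top_of_pos (hb : IsSlowlyVarying b) {q : ℝ≥0∞}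
    (hq : q ≠ 0) {r : ℝ} (hr : 0 < r) :
    eLpNorm (lkWeight (r - q⁻¹.toReal) b) q (volume.restrict (Ioo 0 1)) < ∞ := by
  obtain ⟨M, hM, h⟩ := hb.exists_le_rpow (half_pos hr) (T := 1)
  have hle : ∀ t ∈ Ioo (0 : ℝ) 1,
      lkWeight (r - q⁻¹.toReal) b t ≤ ENNReal.ofReal (M * t ^ (r / 2 - q⁻¹.toReal)) := by
    intro t ht
    refine ENNReal.ofReal_le_ofReal ?_
    calc t ^ (r - q⁻¹.toReal) * b t ≤ t ^ (r - q⁻¹.toReal) * (M * t ^ (-(r / 2))) :=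
          mul_le_mul_of_nonneg_left (h t ht.1 ht.2.le) (Real.rpow_nonneg ht.1.le _)
      _ = M * (t ^ (r - q⁻¹.toReal) * t ^ (-(r / 2))) := by ring
      _ = _ := by rw [← Real.rpow_add ht.1]; ring_nf
  by_cases hqt : q = ∞
  · subst hqt
    refine eLpNorm_restrict_lt_top_of_le measurableSet_Ioo (by simp)
      (M := ENNReal.ofReal M) ENNReal.ofReal_ne_top fun t ht => (hle t ht).trans ?_
    refine ENNReal.ofReal_le_ofReal (mul_le_of_le_one_right hM ?_)
    exact Real.rpow_le_one ht.1.le ht.2.le (by simpa using (half_pos hr).le)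
  · have hq0 : 0 < q.toReal := ENNReal.toReal_pos hq hqt
    rw [eLpNorm_eq_lintegral_rpow_enorm_toReal hq hqt]
    refine ENNReal.rpow_lt_top_of_nonneg (by positivity) (ne_of_lt ?_)
    have hint : IntegrableOn (fun t : ℝ => M ^ q.toReal * t ^ (r / 2 * q.toReal - 1)) (Ioo 0 1) :=
      ((intervalIntegral.integrableOn_Ioo_rpow_iff one_pos).2
        (by have : 0 < r / 2 * q.toReal := by positivity
            linarith)).const_mul _
    refine lt_of_le_of_lt (setLIntegral_mono' measurableSet_Ioo fun t ht => ?_)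
      hint.lintegral_lt_top
    rw [enorm_eq_self]
    refine (ENNReal.rpow_le_rpow (hle t ht) hq0.le).trans (le_of_eq ?_)
    have ht0 := ht.1.le
    rw [ENNReal.ofReal_rpow_of_nonneg (by positivity) hq0.le,
      Real.mul_rpow hM (by positivity), ← Real.rpow_mul ht0, sub_mul, ENNReal.toReal_inv,
      inv_mul_cancel₀ hq0.ne']

end SlowlyVarying

section Main

variable {X : Type*} [MeasurableSpace X] {μ : Measure X} {p q : ℝ≥0∞} {b : ℝ → ℝ}

lemma lkNorm_eq_eLpNorm (hq : q ≠ 0) (f : X → ℝ) :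
    lkNorm μ p q b f = eLpNorm
      (fun t => lkWeight (p⁻¹.toReal - q⁻¹.toReal) b t * rearr μ f t) q
      (volume.restrict (Ioi 0)) :=
  lqNorm_eq_eLpNorm hq _ _

lemma IsSlowlyVarying.measurable_lkWeight_mul_rearr (hb : IsSlowlyVarying b) (α : ℝ)
    (f : X → ℝ) : Measurable fun t => lkWeight α b t * rearr μ f t :=
  (hb.measurable_lkWeight α).mul (rearr_measurable f)

lemma lkNorm_mono (hq : q ≠ 0) {f g : X → ℝ} (h : ∀ᵐ x ∂μ, |f x| ≤ |g x|) :
    lkNorm μ p q b f ≤ lkNorm μ p q b g := by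
  simp only [lkNorm_eq_eLpNorm hq]
  refine eLpNorm_mono_enorm fun t => ?_
  simpa using mul_le_mul_right (rearr_mono h t) _

lemma lkNorm_const_mul_le (hq : q ≠ 0) (a : ℝ) (f : X → ℝ) :
    lkNorm μ p q b (fun x => a * f x) ≤ ENNReal.ofReal |a| * lkNorm μ p q b f := by
  simp only [lkNorm_eq_eLpNorm hq]
  refine eLpNorm_le_mul_eLpNorm_of_ae_le_mul' (c := |a|.toNNReal) (ae_of_all _ fun t => ?_) q
  simp only [enorm_eq_self]
  rw [mul_left_comm]
  exact mul_le_mul_right (rearr_const_mul_le a f t) _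

lemma lkNorm_eq_zero_iff (hq : q ≠ 0) (hb : IsSlowlyVarying b) (f : X → ℝ) :
    lkNorm μ p q b f = 0 ↔ f =ᵐ[μ] 0 := by
  rw [lkNorm_eq_eLpNorm hq, eLpNorm_eq_zero_iff
    (hb.measurable_lkWeight_mul_rearr _ f).aestronglyMeasurable hq]
  refine ⟨fun h => ae_eq_zero_of_rearr_eq_zero fun t ht => ?_, fun h => ?_⟩
  · by_contra hne
    have hsub : Ioo (0 : ℝ) t ⊆ {s | ¬ (s ∈ Ioi (0 : ℝ) →
        lkWeight (p⁻¹.toReal - q⁻¹.toReal) b s * rearr μ f s = 0)} := by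
      intro s hs hcon
      rcases mul_eq_zero.1 (hcon hs.1) with h1 | h1
      · exact (hb.lkWeight_pos _ hs.1).ne' h1
      · exact hne (le_antisymm ((rearr_antitone f hs.2.le).trans h1.le) zero_le)
    have hnull := measure_mono_null hsub (ae_iff.1 ((ae_restrict_iff' measurableSet_Ioi).1 h))
    simp [ht.not_ge] at hnull
  · refine ae_of_all _ fun t => ?_
    simp [rearr_eq_zero_of_ae_eq_zero h]

lemma exists_lkNorm_add_le (hq : q ≠ 0) (hb : IsSlowlyVarying b) :
    ∃ C : ℝ≥0∞, C < ∞ ∧ ∀ f g : X → ℝ,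
      lkNorm μ p q b (fun x => f x + g x) ≤ C * (lkNorm μ p q b f + lkNorm μ p q b g) := by
  simp only [lkNorm_eq_eLpNorm hq]
  set α := p⁻¹.toReal - q⁻¹.toReal
  obtain ⟨K, hK, hdbl⟩ := hb.exists_lkWeight_two_mul_le α
  have hD : (2 : ℝ≥0∞) ^ (1 / q).toReal < ∞ :=
    ENNReal.rpow_lt_top_of_nonneg ENNReal.toReal_nonneg ENNReal.ofNat_ne_top
  refine ⟨K * (2 ^ (1 / q).toReal * q.LpAddConst),
    ENNReal.mul_lt_top hK (ENNReal.mul_lt_top hD (ENNReal.LpAddConst_lt_top q)), fun f g => ?_⟩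
  have hm := hb.measurable_lkWeight_mul_rearr (μ := μ) α
  let F : ℝ → ℝ≥0∞ := (fun t => lkWeight α b t * rearr μ f t) + fun t =>
    lkWeight α b t * rearr μ g t
  have hF : Measurable F := (hm f).add (hm g)
  calc eLpNorm (fun t => lkWeight α b t * rearr μ (fun x => f x + g x) t) q
        (volume.restrict (Ioi 0))
      ≤ K * eLpNorm (fun t => F (2⁻¹ * t)) q (volume.restrict (Ioi 0)) := by
        lift K to NNReal using hK.ne
        refine eLpNorm_le_mul_eLpNorm_of_ae_le_mul' ?_ q
        filter_upwards [ae_restrict_mem measurableSet_Ioi] with t ht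
        have ht' : (0 : ℝ) < 2⁻¹ * t := mul_pos (by norm_num) ht
        have hadd := rearr_add_le (μ := μ) f g ht'.le ht'.le
        rw [show 2⁻¹ * t + 2⁻¹ * t = t by ring] at hadd
        have hw := hdbl (2⁻¹ * t) ht'
        rw [show 2 * (2⁻¹ * t) = t by ring] at hw
        simp only [enorm_eq_self, F, Pi.add_apply]
        rw [← mul_add, ← mul_assoc]
        exact mul_le_mul' hw hadd
    _ ≤ K * (2 ^ (1 / q).toReal * eLpNorm F q (volume.restrict (Ioi 0))) := by
        gcongr
        exact eLpNorm_comp_half_le hF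
    _ ≤ K * (2 ^ (1 / q).toReal * (q.LpAddConst * _)) := by
        gcongr
        exact eLpNorm_add_le' (hm f).aestronglyMeasurable (hm g).aestronglyMeasurable q
    _ = _ := by simp only [mul_assoc]

lemma lkNorm_eq_iSup (hq : q ≠ 0) (hb : IsSlowlyVarying b) {f : ℕ → X → ℝ} {g : X → ℝ}
    (h0 : ∀ᵐ x ∂μ, ∀ n, 0 ≤ f n x) (hmono : ∀ᵐ x ∂μ, Monotone fun n => f n x)
    (hlim : ∀ᵐ x ∂μ, Tendsto (fun n => f n x) atTop (𝓝 (g x))) :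
    lkNorm μ p q b g = ⨆ n, lkNorm μ p q b (f n) := by
  simp only [lkNorm_eq_eLpNorm hq]
  rw [← eLpNorm_iSup_of_monotone q
    (fun n => hb.measurable_lkWeight_mul_rearr _ (f n))]
  · congr 1
    ext t
    rw [rearr_eq_iSup h0 hmono hlim, ENNReal.mul_iSup]
  · intro m n hmn t
    refine mul_le_mul_right (rearr_mono ?_ t) _
    filter_upwards [h0, hmono] with x hx0 hx
    rw [abs_of_nonneg (hx0 m), abs_of_nonneg (hx0 n)]
    exact hx hmn

lemma lkNorm_indicator_lt_top (hq : q ≠ 0) (hb : IsSlowlyVarying b)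
    (h : eLpNorm (lkWeight (p⁻¹.toReal - q⁻¹.toReal) b) q (volume.restrict (Ioo 0 1)) < ∞)
    {E : Set X} (hE : μ E < ∞) : lkNorm μ p q b (E.indicator fun _ => (1 : ℝ)) < ∞ := by
  rw [lkNorm_eq_eLpNorm hq]
  refine lt_of_le_of_lt ?_ (hb.eLpNorm_lkWeight_Ioo_lt_top one_pos h (T := (μ E).toReal))
  rw [← eLpNorm_indicator_eq_eLpNorm_restrict measurableSet_Ioo]
  refine le_trans (eLpNorm_mono_enorm_ae ?_) (eLpNorm_mono_measure _ Measure.restrict_le_self)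
  filter_upwards [ae_restrict_mem measurableSet_Ioi] with t ht
  simp only [enorm_eq_self]
  refine (mul_le_mul_right (rearr_indicator_le hE ht) _).trans ?_
  by_cases hm : t ∈ Ioo 0 (μ E).toReal <;> simp [hm]

/-- If the weight is not integrable near the origin, the Lorentz–Karamata space is trivial. -/
lemma ae_eq_zero_of_lkNorm_lt_top (hq : q ≠ 0) (hb : IsSlowlyVarying b)
    (h : ¬ eLpNorm (lkWeight (p⁻¹.toReal - q⁻¹.toReal) b) q (volume.restrict (Ioo 0 1)) < ∞)
    {f : X → ℝ} (hf : lkNorm μ p q b f < ∞) : f =ᵐ[μ] 0 := by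
  refine ae_eq_zero_of_rearr_eq_zero fun t ht => ?_
  by_contra hne
  refine h (hb.eLpNorm_lkWeight_Ioo_lt_top ht ?_)
  rw [lkNorm_eq_eLpNorm hq] at hf
  obtain ⟨c, hc0, hc⟩ := ENNReal.lt_iff_exists_nnreal_btwn.1 (pos_iff_ne_zero.2 hne)
  have hc0' : c ≠ 0 := by simpa using hc0.ne'
  refine lt_of_le_of_lt (eLpNorm_le_mul_eLpNorm_of_ae_le_mul' (c := c⁻¹)
    (g := fun t => lkWeight (p⁻¹.toReal - q⁻¹.toReal) b t * rearr μ f t) ?_ q)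
    (ENNReal.mul_lt_top ENNReal.coe_lt_top ((eLpNorm_mono_measure _
      (Measure.restrict_mono (fun s hs => hs.1) le_rfl)).trans_lt hf))
  filter_upwards [ae_restrict_mem measurableSet_Ioo] with s hs
  have hcs : (c : ℝ≥0∞) ≤ rearr μ f s := hc.le.trans (rearr_antitone f hs.2.le)
  simp only [enorm_eq_self]
  rw [mul_left_comm, ENNReal.coe_inv hc0']
  refine le_mul_of_one_le_right' ?_
  rw [← ENNReal.inv_mul_cancel (a := (c : ℝ≥0∞)) (by simpa using hc0') ENNReal.coe_ne_top]
  exact mul_le_mul_right hcs _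

lemma isRIQuasiBFN_lkNorm (hq : q ≠ 0) (hb : IsSlowlyVarying b)
    (h : eLpNorm (lkWeight (p⁻¹.toReal - q⁻¹.toReal) b) q (volume.restrict (Ioo 0 1)) < ∞) :
    IsRIQuasiBFN μ (lkNorm μ p q b) where
  abs_eq f _ := by simp only [lkNorm, rearr, abs_abs]
  smul a f _ := by
    refine le_antisymm (lkNorm_const_mul_le hq a f) ?_
    by_cases ha : a = 0
    · simp [ha]
    have hinv := lkNorm_const_mul_le (μ := μ) (p := p) (b := b) hq a⁻¹ (fun x => a * f x)
    simp only [inv_mul_cancel_left₀ ha] at hinv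
    calc ENNReal.ofReal |a| * lkNorm μ p q b f
        ≤ ENNReal.ofReal |a| * (ENNReal.ofReal |a⁻¹| * lkNorm μ p q b fun x => a * f x) := by
          gcongr
      _ = lkNorm μ p q b fun x => a * f x := by
          rw [← mul_assoc, ← ENNReal.ofReal_mul (abs_nonneg a), ← abs_mul, mul_inv_cancel₀ ha]
          simp
  eq_zero_iff f _ := lkNorm_eq_zero_iff hq hb f
  quasi_add := by
    obtain ⟨C, hC, h⟩ := exists_lkNorm_add_le (μ := μ) (p := p) hq hb
    exact ⟨C, hC, fun f g _ _ => h f g⟩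
  mono _ _ _ _ h := lkNorm_mono hq h
  fatou _ _ _ _ h0 hmono hlim := lkNorm_eq_iSup hq hb h0 hmono hlim
  ind_lt_top _ _ hE := lkNorm_indicator_lt_top hq hb h hE
  rearr_inv f g _ _ h := by simp only [lkNorm, h]

end Main

/-- Proposition LQ: `‖·‖_{p,q,b}` is an r.i. quasi-Banach function norm
iff `p < ∞`, or `p = ∞` and `‖t^{-1/q} b(t) χ_(0,1)‖_q < ∞`; otherwise `L^{p,q,b}` is
trivial. -/
theorem lkNorm_isRIQuasiBFN_iff {X : Type*} [MeasurableSpace X] (μ : Measure X)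
    [SigmaFinite μ] (hna : IsNonatomic μ) (hμ : μ Set.univ = ∞)
    (p q : ℝ≥0∞) (hp : 0 < p) (hq : 0 < q) (b : ℝ → ℝ) (hb : IsSlowlyVarying b) :
    (IsRIQuasiBFN μ (lkNorm μ p q b) ↔
      (p < ∞ ∨ (p = ∞ ∧ weightNorm ∞ q b (Set.Ioo 0 1) < ∞))) ∧
    (¬(p < ∞ ∨ (p = ∞ ∧ weightNorm ∞ q b (Set.Ioo 0 1) < ∞)) →
      ∀ f : X → ℝ, Measurable f → lkNorm μ p q b f < ∞ → f =ᵐ[μ] 0) := by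

  have hq0 : q ≠ 0 := hq.ne'
  have key : (p < ∞ ∨ (p = ∞ ∧ weightNorm ∞ q b (Set.Ioo 0 1) < ∞)) ↔
      eLpNorm (lkWeight (p⁻¹.toReal - q⁻¹.toReal) b) q (volume.restrict (Ioo 0 1)) < ∞ := by
    rcases eq_or_ne p ∞ with rfl | hpt
    · simp only [lt_irrefl, false_or, true_and]
      rw [weightNorm, lqNorm_eq_eLpNorm hq0]
      rfl
    · have hr : 0 < p⁻¹.toReal :=
        ENNReal.toReal_pos (ENNReal.inv_ne_zero.2 hpt) (ENNReal.inv_ne_top.2 hp.ne')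
      exact iff_of_true (Or.inl hpt.lt_top) (hb.eLpNorm_lkWeight_lt_top_of_pos hq0 hr)
  rw [key]
  refine ⟨⟨fun hN => ?_, isRIQuasiBFN_lkNorm hq0 hb⟩,
    fun h f _ hf => ae_eq_zero_of_lkNorm_lt_top hq0 hb h hf⟩
  by_contra h
  obtain ⟨E, -, hEm, hE0, hEtop⟩ := hna univ MeasurableSet.univ (by simp [hμ])
  rw [hμ] at hEtop
  have hzero := ae_eq_zero_of_lkNorm_lt_top hq0 hb h (hN.ind_lt_top E hEm hEtop)
  refine hE0.ne' (measure_mono_null (fun x hx => ?_) (ae_iff.1 hzero))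
  simp [hx]
end

section
/- Let b be a slowly varying function and p, q ∈ (0,∞]. Suppose that either (a) p < q ≤ 1, or (b) p = q ≤ 1 and lim_{t→0⁺} b(t) = 0. Then ‖·‖_{p,q,b} does not satisfy property (P5); that is, there exists E ⊆ R with 0 < μ(E) < ∞ such that for no finite constant C_E does ∫_E |f| dμ ≤ C_E ‖f‖_{p,q,b} hold for all μ-measurable f. -/
open MeasureTheory Set Filter ENNReal Topology

/-- In a non-atomic measure space every set of positive finite measure has a measurable subset
of arbitrarily small positive measure. -/
theorem IsNonatomic.exists_subset_le {X : Type*} [MeasurableSpace X] {μ : Measure X}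
    (hna : IsNonatomic μ) {E : Set X} (hE : MeasurableSet E) (h0 : 0 < μ E) (hfin : μ E < ∞)
    {δ : ℝ≥0∞} (hδ : 0 < δ) :
    ∃ A ⊆ E, MeasurableSet A ∧ 0 < μ A ∧ μ A ≤ δ := by
  have halving : ∀ s ⊆ E, MeasurableSet s → 0 < μ s →
      ∃ t ⊆ s, MeasurableSet t ∧ 0 < μ t ∧ μ t ≤ μ s / 2 := by
    intro s hsE hs hs0
    obtain ⟨t, hts, ht, ht0, htlt⟩ := hna s hs hs0
    have hsfin : μ s ≠ ∞ := ((measure_mono hsE).trans_lt hfin).ne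
    have htfin : μ t ≠ ∞ := htlt.ne_top
    have hdiff : μ (s \ t) = μ s - μ t := measure_sdiff hts ht.nullMeasurableSet htfin
    rcases le_total (μ t) (μ s / 2) with h | h
    · exact ⟨t, hts, ht, ht0, h⟩
    · refine ⟨s \ t, sdiff_subset, hs.diff ht, ?_, ?_⟩
      · rw [hdiff]
        exact tsub_pos_of_lt htlt
      · rw [hdiff, tsub_le_iff_right]
        calc μ s = μ s / 2 + μ s / 2 := (ENNReal.add_halves _).symm
          _ ≤ μ s / 2 + μ t := by gcongr
  have iter : ∀ n : ℕ, ∃ A ⊆ E, MeasurableSet A ∧ 0 < μ A ∧ μ A ≤ μ E * 2⁻¹ ^ n := by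
    intro n
    induction n with
    | zero => exact ⟨E, Subset.rfl, hE, h0, by simp⟩
    | succ n ih =>
      obtain ⟨A, hAE, hA, hA0, hAle⟩ := ih
      obtain ⟨t, htA, ht, ht0, htle⟩ := halving A hAE hA hA0
      refine ⟨t, htA.trans hAE, ht, ht0, htle.trans ?_⟩
      rw [pow_succ, ← mul_assoc, ENNReal.div_eq_inv_mul, mul_comm]
      gcongr
  have hlim : Tendsto (fun n : ℕ => μ E * 2⁻¹ ^ n) atTop (𝓝 0) := by
    simpa using ENNReal.Tendsto.const_mul
      (ENNReal.tendsto_pow_atTop_nhds_zero_of_lt_one (r := 2⁻¹) (by norm_num))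
      (Or.inr hfin.ne)
  obtain ⟨n, hn⟩ := (hlim.eventually (gt_mem_nhds hδ)).exists
  obtain ⟨A, hAE, hA, hA0, hAle⟩ := iter n
  exact ⟨A, hAE, hA, hA0, hAle.trans hn.le⟩

theorem rearr_indicator_one_le_one {X : Type*} [MeasurableSpace X] (μ : Measure X) (A : Set X)
    (t : ℝ) : rearr μ (A.indicator fun _ => (1 : ℝ)) t ≤ 1 := by
  refine sInf_le ?_
  have : {x | (1 : ℝ≥0∞) < ENNReal.ofReal |A.indicator (fun _ => (1 : ℝ)) x|} = ∅ := by
    ext x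
    by_cases hx : x ∈ A <;> simp [hx]
  rw [mem_ofPred_eq, this, measure_empty]
  exact zero_le

theorem rearr_indicator_one_eq_zero {X : Type*} [MeasurableSpace X] (μ : Measure X) {A : Set X}
    {t : ℝ} (ht : μ A ≤ ENNReal.ofReal t) :
    rearr μ (A.indicator fun _ => (1 : ℝ)) t = 0 := by
  refine le_antisymm (sInf_le ((measure_mono fun x hx => ?_).trans ht)) zero_le
  by_contra hxA
  simp [hxA] at hx

/-- A slowly varying function grows at `0` slower than any negative power. -/
theorem IsSlowlyVarying.tendsto_rpow_mul {b : ℝ → ℝ} (hb : IsSlowlyVarying b) {r : ℝ}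
    (hr : 0 < r) : Tendsto (fun t => t ^ r * b t) (𝓝[>] 0) (𝓝 0) := by
  obtain ⟨-, hpos, hsv⟩ := hb
  obtain ⟨⟨g, hg, c, C, -, hC, hgC⟩, -⟩ := hsv (r / 2) (half_pos hr)
  have hlim : Tendsto (fun t : ℝ => t ^ (r / 2) * (C * g 1)) (𝓝[>] 0) (𝓝 0) := by
    have h := (Real.continuousAt_rpow_const 0 (r / 2) (Or.inr (half_pos hr).le)).tendsto
    rw [Real.zero_rpow (half_pos hr).ne'] at h
    simpa using (h.mono_left nhdsWithin_le_nhds).mul_const (C * g 1)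
  refine tendsto_of_tendsto_of_tendsto_of_le_of_le' tendsto_const_nhds hlim ?_ ?_
  · filter_upwards [self_mem_nhdsWithin] with t ht
    exact mul_nonneg (Real.rpow_nonneg (le_of_lt ht) _) (hpos t ht).le
  · filter_upwards [Ioc_mem_nhdsGT (zero_lt_one (α := ℝ))] with t ht
    have hsplit : t ^ r = t ^ (r / 2) * t ^ (r / 2) := by
      rw [← Real.rpow_add ht.1, add_halves]
    rw [hsplit, mul_assoc]
    refine mul_le_mul_of_nonneg_left ?_ (Real.rpow_nonneg ht.1.le _)
    exact (hgC t ht.1).2.trans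
      (mul_le_mul_of_nonneg_left (hg ht.1 (mem_Ioi.2 one_pos) ht.2) hC.le)

/-- If `t ^ (1/p - 1) * b t ≤ η` up to `t = μ A`, then the functional of the indicator of `A`
is at most `η q ^ (-1/q) μ A`. -/
theorem lkNorm_indicator_one_le {X : Type*} [MeasurableSpace X] {μ : Measure X} {p q : ℝ≥0∞}
    (hq : 0 < q) (hq' : q ≠ ∞) {b : ℝ → ℝ} {A : Set X} (hA : μ A ≠ ∞) {η : ℝ} (hη : 0 ≤ η)
    (h : ∀ t, 0 < t → t < (μ A).toReal → t ^ (p⁻¹.toReal - 1) * b t ≤ η) :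
    lkNorm μ p q b (A.indicator fun _ => (1 : ℝ)) ≤
      ENNReal.ofReal (η * (μ A).toReal * q.toReal⁻¹ ^ (1 / q.toReal)) := by
  set s := (μ A).toReal
  set r := q.toReal
  have hr0 : 0 < r := ENNReal.toReal_pos hq.ne' hq'
  have hs0 : 0 ≤ s := ENNReal.toReal_nonneg
  rw [lkNorm, lqNorm, if_neg hq']
  have hpt : ∀ t ∈ Ioi (0 : ℝ),
      (ENNReal.ofReal (t ^ (p⁻¹.toReal - q⁻¹.toReal) * b t) *
        rearr μ (A.indicator fun _ => (1 : ℝ)) t) ^ r ≤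
      (Iio s).indicator (fun t => ENNReal.ofReal (η ^ r * t ^ (r - 1))) t := by
    intro t ht
    rw [mem_Ioi] at ht
    by_cases hts : t < s
    · rw [indicator_of_mem (mem_Iio.2 hts)]
      have hle : t ^ (p⁻¹.toReal - q⁻¹.toReal) * b t ≤ η * t ^ (1 - r⁻¹) := by
        have hsplit : t ^ (p⁻¹.toReal - q⁻¹.toReal) = t ^ (p⁻¹.toReal - 1) * t ^ (1 - r⁻¹) := by
          rw [← Real.rpow_add ht, ENNReal.toReal_inv q]
          congr 1
          ring
        rw [hsplit, mul_right_comm]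
        exact mul_le_mul_of_nonneg_right (h t ht hts) (Real.rpow_nonneg ht.le _)
      have hpow : η ^ r * t ^ (r - 1) = (η * t ^ (1 - r⁻¹)) ^ r := by
        rw [Real.mul_rpow hη (Real.rpow_nonneg ht.le _), ← Real.rpow_mul ht.le]
        congr 2
        field_simp
      rw [hpow, ← ENNReal.ofReal_rpow_of_nonneg
        (mul_nonneg hη (Real.rpow_nonneg ht.le _)) hr0.le]
      refine ENNReal.rpow_le_rpow ?_ hr0.le
      exact (mul_le_mul' (ENNReal.ofReal_le_ofReal hle)
        (rearr_indicator_one_le_one μ A t)).trans_eq (mul_one _)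
    · have hAt : μ A ≤ ENNReal.ofReal t :=
        (ENNReal.le_ofReal_iff_toReal_le hA ht.le).2 (not_lt.1 hts)
      rw [rearr_indicator_one_eq_zero μ hAt, mul_zero, ENNReal.zero_rpow_of_pos hr0]
      exact zero_le
  have hint : IntervalIntegrable (fun t : ℝ => η ^ r * t ^ (r - 1)) volume 0 s :=
    (intervalIntegral.intervalIntegrable_rpow' (by linarith)).const_mul _
  have hval : ∫⁻ t in Ioc 0 s, ENNReal.ofReal (η ^ r * t ^ (r - 1)) =
      ENNReal.ofReal (η ^ r * (s ^ r * r⁻¹)) := by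
    rw [← ofReal_integral_eq_lintegral_ofReal, ← intervalIntegral.integral_of_le hs0,
      intervalIntegral.integral_const_mul, integral_rpow (Or.inl (by linarith)), sub_add_cancel,
      Real.zero_rpow hr0.ne', sub_zero, div_eq_mul_inv]
    · exact (intervalIntegrable_iff_integrableOn_Ioc_of_le hs0).1 hint
    · filter_upwards [ae_restrict_mem measurableSet_Ioc] with t ht
      exact mul_nonneg (Real.rpow_nonneg hη _) (Real.rpow_nonneg ht.1.le _)
  have hroot : (η ^ r * (s ^ r * r⁻¹)) ^ (1 / r) = η * s * r⁻¹ ^ (1 / r) := by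
    rw [← mul_assoc, ← Real.mul_rpow hη hs0,
      Real.mul_rpow (Real.rpow_nonneg (mul_nonneg hη hs0) _) (inv_nonneg.2 hr0.le),
      ← Real.rpow_mul (mul_nonneg hη hs0), mul_one_div_cancel hr0.ne', Real.rpow_one]
  rw [← hroot, ← ENNReal.ofReal_rpow_of_nonneg (by positivity) (by positivity), ← hval]
  refine ENNReal.rpow_le_rpow ((setLIntegral_mono' measurableSet_Ioi hpt).trans ?_) (by positivity)
  rw [lintegral_indicator measurableSet_Iio, Measure.restrict_restrict measurableSet_Iio]
  exact lintegral_mono_set fun t ht => ⟨ht.2, ht.1.le⟩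

/-- Proposition LP5, part (ii): sufficient conditions for `‖·‖_{p,q,b}`
to fail property (P5). -/
theorem lkNorm_not_P5_of {X : Type*} [MeasurableSpace X] (μ : Measure X)
    [SigmaFinite μ] (hna : IsNonatomic μ) (hμ : μ Set.univ = ∞)
    (p q : ℝ≥0∞) (hp : 0 < p) (hq : 0 < q) (b : ℝ → ℝ) (hb : IsSlowlyVarying b)
    (hpq : (p < q ∧ q ≤ 1) ∨
      (p = q ∧ q ≤ 1 ∧ Filter.Tendsto b (nhdsWithin (0:ℝ) (Set.Ioi 0)) (nhds 0))) :
    ∃ E : Set X, MeasurableSet E ∧ 0 < μ E ∧ μ E < ∞ ∧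
      ∀ C : ℝ≥0∞, C < ∞ → ∃ f : X → ℝ, Measurable f ∧
        ¬(∫⁻ x in E, ENNReal.ofReal |f x| ∂μ ≤ C * lkNorm μ p q b f) := by
  have hq1 : q ≤ 1 := by rcases hpq with h | h; exacts [h.2, h.2.1]
  have hq' : q ≠ ∞ := (hq1.trans_lt one_lt_top).ne
  have hlim : Tendsto (fun t => t ^ (p⁻¹.toReal - 1) * b t) (𝓝[>] 0) (𝓝 0) := by
    rcases hpq with ⟨hpq, -⟩ | ⟨rfl, -, hb0⟩
    · refine hb.tendsto_rpow_mul (sub_pos.2 ?_)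
      rw [← ENNReal.toReal_one,
        ENNReal.toReal_lt_toReal ENNReal.one_ne_top (ENNReal.inv_ne_top.2 hp.ne')]
      exact ENNReal.one_lt_inv.2 (hpq.trans_le hq1)
    · have hexp : 0 ≤ p⁻¹.toReal - 1 := by
        rw [sub_nonneg, ← ENNReal.toReal_one,
          ENNReal.toReal_le_toReal ENNReal.one_ne_top (ENNReal.inv_ne_top.2 hp.ne')]
        exact ENNReal.one_le_inv.2 hq1
      refine tendsto_of_tendsto_of_tendsto_of_le_of_le' tendsto_const_nhds hb0 ?_ ?_
      · filter_upwards [self_mem_nhdsWithin] with t ht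
        exact mul_nonneg (Real.rpow_nonneg (le_of_lt ht) _) (hb.2.1 t ht).le
      · filter_upwards [Ioc_mem_nhdsGT (zero_lt_one (α := ℝ))] with t ht
        exact mul_le_of_le_one_left (hb.2.1 t ht.1).le
          (Real.rpow_le_one ht.1.le ht.2 hexp)
  obtain ⟨E, hE, -, hE0, hEfin⟩ : ∃ E, MeasurableSet E ∧ E ⊆ univ ∧ 0 < μ E ∧ μ E < ∞ :=
    Measure.exists_subset_measure_lt_top MeasurableSet.univ (by simp [hμ])
  refine ⟨E, hE, hE0, hEfin, fun C hC => ?_⟩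
  set r := q.toReal
  have hr0 : 0 < r := ENNReal.toReal_pos hq.ne' hq'
  set c := C.toReal with hc
  have hc0 : 0 ≤ c := ENNReal.toReal_nonneg
  set k := r⁻¹ ^ (1 / r)
  have hk0 : 0 < k := Real.rpow_pos_of_pos (inv_pos.2 hr0) _
  set η := ((c + 1) * k)⁻¹ with hη
  have hη0 : 0 < η := by positivity
  obtain ⟨δ, hδ0, hδ⟩ := mem_nhdsGT_iff_exists_Ioo_subset.1 (hlim.eventually (gt_mem_nhds hη0))
  obtain ⟨A, hAE, hA, hA0, hAδ⟩ :=
    hna.exists_subset_le hE hE0 hEfin (ENNReal.ofReal_pos.2 hδ0)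
  have hAfin : μ A ≠ ∞ := (hAδ.trans_lt ENNReal.ofReal_lt_top).ne
  have hs0 : 0 < (μ A).toReal := ENNReal.toReal_pos hA0.ne' hAfin
  have hsδ : (μ A).toReal ≤ δ := ENNReal.toReal_le_of_le_ofReal (le_of_lt hδ0) hAδ
  have hnorm := lkNorm_indicator_one_le (p := p) hq hq' (b := b) hAfin hη0.le
    fun t ht hts => le_of_lt (hδ ⟨ht, hts.trans_le hsδ⟩)
  refine ⟨A.indicator fun _ => (1 : ℝ), measurable_const.indicator hA, not_le.2 ?_⟩
  have hint : ∫⁻ x in E, ENNReal.ofReal |A.indicator (fun _ => (1 : ℝ)) x| ∂μ = μ A := by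
    have hfun : (fun x => ENNReal.ofReal |A.indicator (fun _ => (1 : ℝ)) x|) =
        A.indicator fun _ => 1 := by
      ext x
      by_cases hx : x ∈ A <;> simp [hx]
    rw [hfun, lintegral_indicator_const hA, one_mul, Measure.restrict_apply hA,
      inter_eq_left.2 hAE]
  rw [hint]
  calc C * lkNorm μ p q b (A.indicator fun _ => (1 : ℝ))
      ≤ ENNReal.ofReal c * ENNReal.ofReal (η * (μ A).toReal * k) := by
        rw [hc, ENNReal.ofReal_toReal hC.ne]
        gcongr
    _ = ENNReal.ofReal (c * (η * (μ A).toReal * k)) := (ENNReal.ofReal_mul hc0).symm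
    _ < ENNReal.ofReal (μ A).toReal := by
        refine (ENNReal.ofReal_lt_ofReal_iff hs0).2 ?_
        have : c * (η * (μ A).toReal * k) = c / (c + 1) * (μ A).toReal := by
          rw [hη]
          field_simp
        rw [this]
        exact mul_lt_of_lt_one_left hs0 ((div_lt_one (by positivity)).2 (lt_add_one c))
    _ = μ A := ENNReal.ofReal_toReal hAfin
end
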